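/- arXiv:1408.0451 — 2 statements merged into one kernel-verified Lean document; each statement's English description precedes it below -/
import Mathlib

section
/- A generalized trapezoidal word w is rich if and only if the heart of w is rich. -/
open List

variable {A : Type*} [DecidableEq A]

/-- The alphabet of a word: the finite set of distinct letters occurring in it. -/
def Alph (w : List A) : Finset A := w.toFinset

/-- The finset of all factors (contiguous subwords) of `w`. -/
def factors (w : List A) : Finset (List A) :=
  ((Finset.range (w.length + 1)) ×ˢ (Finset.range (w.length + 1))).image
    (fun p => (w.drop p.1).take p.2)

/-- Factor complexity: the number of distinct factors of `w` of length `n`. -/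
def C (w : List A) (n : ℕ) : ℕ := ((factors w).filter (fun u => u.length = n)).card

/-- Right-valence of `u` in `w`: the number of distinct letters `x` such that `u ++ [x]`
is a factor of `w`. -/
def rightValence (w u : List A) : ℕ := ((Alph w).filter (fun x => u ++ [x] <:+: w)).card

/-- `u` is a right special factor of `w`. -/
def RightSpecial (w u : List A) : Prop := u <:+: w ∧ 2 ≤ rightValence w u

/-- `R w`: the smallest positive integer `r` such that `w` has no right special factor
of length `r`. -/
noncomputable def R (w : List A) : ℕ :=
  sInf {r : ℕ | 0 < r ∧ ∀ u : List A, u.length = r → ¬ RightSpecial w u}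

/-- The number of occurrences of `u` as a factor of `w`. -/
def occCount (w u : List A) : ℕ :=
  ((Finset.range (w.length + 1)).filter
    (fun i => i + u.length ≤ w.length ∧ (w.drop i).take u.length = u)).card

/-- `K w`: the length of the shortest suffix of `w` occurring exactly once in `w`. -/
noncomputable def K (w : List A) : ℕ :=
  sInf {k : ℕ | ∃ u : List A, u <:+ w ∧ u.length = k ∧ occCount w u = 1}

/-- Left-valence of `u` in `w`. -/
def leftValence (w u : List A) : ℕ := ((Alph w).filter (fun x => x :: u <:+: w)).card

/-- `u` is a left special factor of `w`. -/
def LeftSpecial (w u : List A) : Prop := u <:+: w ∧ 2 ≤ leftValence w u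

/-- `L w`: the smallest positive integer `ℓ` such that `w` has no left special factor
of length `ℓ`. -/
noncomputable def L (w : List A) : ℕ :=
  sInf {r : ℕ | 0 < r ∧ ∀ u : List A, u.length = r → ¬ LeftSpecial w u}

/-- `H w`: the length of the shortest prefix of `w` occurring exactly once in `w`. -/
noncomputable def H (w : List A) : ℕ :=
  sInf {k : ℕ | ∃ u : List A, u <+: w ∧ u.length = k ∧ occCount w u = 1}

/-- A generalized trapezoidal word. -/
def IsGT (w : List A) : Prop :=
  w ≠ [] ∧ ((Alph w).card = 1 ∨
    ∃ m M : ℕ, 0 < m ∧ m ≤ M ∧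
      (∀ i, 1 ≤ i → i ≤ m → C w i = (Alph w).card + i - 1) ∧
      (∀ i, m ≤ i → i ≤ M - 1 → C w (i + 1) = C w i) ∧
      (∀ i, M ≤ i → i ≤ w.length → C w (i + 1) = C w i - 1))

/-- The heart of a word: remove the longest prefix and longest suffix consisting of
letters that occur exactly once in the word (if some letter repeats); otherwise the
word itself. -/
def heart (w : List A) : List A :=
  if ∀ x ∈ w, w.count x = 1 then w
  else
    ((w.dropWhile (fun x => w.count x == 1)).reverse.dropWhile
      (fun x => w.count x == 1)).reverse

/-- A word is rich if it has exactly `|w| + 1` distinct palindromic factors. -/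
def Rich (w : List A) : Prop :=
  ((factors w).filter (fun u => u.reverse = u)).card = w.length + 1

/-- `p` is a period of `w`. -/
def IsPeriod (w : List A) (p : ℕ) : Prop :=
  0 < p ∧ ∀ i : ℕ, i + p < w.length → w[i]? = w[i + p]?

/-- The minimal period of `w`. -/
noncomputable def minPeriod (w : List A) : ℕ := sInf {p : ℕ | IsPeriod w p}

theorem mem_factors_iff (w u : List A) : u ∈ factors w ↔ u <:+: w := by
  unfold factors
  simp only [Finset.mem_image, Finset.mem_product, Finset.mem_range, Prod.exists]
  constructor
  · rintro ⟨i, j, -, rfl⟩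
    exact (List.take_prefix _ _).isInfix.trans (List.drop_suffix _ _).isInfix
  · rintro ⟨s, t, rfl⟩
    refine ⟨s.length, u.length, ⟨?_, ?_⟩, ?_⟩
    · simp only [List.length_append]; omega
    · simp only [List.length_append]; omega
    · simp

/-- The palindromic factors of a word. -/
def pals (w : List A) : Finset (List A) := (factors w).filter (fun u => u.reverse = u)

theorem mem_pals (w u : List A) : u ∈ pals w ↔ u <:+: w ∧ u.reverse = u := by
  simp [pals, mem_factors_iff]

theorem rich_cons (x : A) (v : List A) (hx : x ∉ v) : Rich (x :: v) ↔ Rich v := by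
  have h : pals (x :: v) = insert [x] (pals v) := by
    ext u
    rw [Finset.mem_insert, mem_pals, mem_pals, List.infix_cons_iff]
    constructor
    · rintro ⟨h1 | h1, h2⟩
      · rcases u with _ | ⟨a, u⟩
        · right; simp
        · rw [List.cons_prefix_cons] at h1
          obtain ⟨rfl, h1⟩ := h1
          left
          rcases List.eq_nil_or_concat u with rfl | ⟨l, b, rfl⟩
          · rfl
          · exfalso
            simp at h2
            apply hx
            apply h1.subset
            simp [h2.1]
      · exact Or.inr ⟨h1, h2⟩
    · rintro (rfl | ⟨h1, h2⟩)
      · simp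
      · exact ⟨Or.inr h1, h2⟩
  have hn : [x] ∉ pals v := by
    rw [mem_pals]
    rintro ⟨h1, -⟩
    exact hx (h1.subset (by simp))
  change (pals (x :: v)).card = _ ↔ (pals v).card = _
  rw [h, Finset.card_insert_of_notMem hn]
  simp

theorem rich_reverse (w : List A) : Rich w.reverse ↔ Rich w := by
  have h : pals w.reverse = pals w := by
    ext u
    rw [mem_pals, mem_pals]
    refine and_congr_left fun hu => ?_
    rw [← hu, List.reverse_infix, hu]
  change (pals w.reverse).card = _ ↔ (pals w).card = _
  rw [h, List.length_reverse]

theorem rich_dropWhile (p : A → Bool) (w : List A) (h : ∀ x, p x = true → w.count x ≤ 1) :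
    Rich (w.dropWhile p) ↔ Rich w := by
  induction w with
  | nil => simp
  | cons a v ih =>
    by_cases hp : p a = true
    · rw [List.dropWhile_cons_of_pos hp, rich_cons]
      · apply ih
        intro x hx
        exact ((List.sublist_cons_self a v).count_le x).trans (h x hx)
      · have := h a hp
        rw [List.count_cons_self] at this
        exact List.count_eq_zero.mp (by omega)
    · rw [List.dropWhile_cons_of_neg hp]

theorem stmt15 (w : List A) (hw : IsGT w) : Rich w ↔ Rich (heart w) := by
  unfold heart
  split_ifs with h
  · rfl
  · rw [rich_reverse, rich_dropWhile, rich_reverse, rich_dropWhile]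
    · intro x hx
      exact (by simpa using hx : w.count x = 1).le
    · intro x hx
      rw [List.count_reverse]
      exact ((List.dropWhile_sublist _).count_le x).trans (by simpa using hx : w.count x = 1).le
end

section
/- Let w be a generalized trapezoidal word with heart v, and let p be the longest palindromic prefix of v and q the longest palindromic suffix of v. Then w is rich if and only if one of the following conditions holds: (i) p and q are unseparated in v, i.e., |p| + |q| ≥ |v|; (ii) v = p·x·q for some letter x with Alph(p) ∩ Alph(q) ≠ ∅ and x ∈ Alph(p) ∪ Alph(q); (iii) v = p·u·q for some nonempty word u with Alph(p) ∩ Alph(q) = ∅, where u = u₁·Z·u₂ for some words u₁, u₂, Z (at least one of which is nonempty) such that Alph(u₁) ⊆ Alph(p), Alph(u₂) ⊆ Alph(q), and Alph(Z) ∩ (Alph(p) ∪ Alph(q)) = ∅. -/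
open List

variable {A : Type*} [DecidableEq A]

set_option linter.unusedSectionVars false
set_option linter.unusedSimpArgs false
set_option linter.unusedVariables false

namespace GTW


theorem mem_factors {w u : List A} : u ∈ factors w ↔ u <:+: w := by
  unfold factors
  simp only [Finset.mem_image, Finset.mem_product, Finset.mem_range, Prod.exists]
  constructor
  · rintro ⟨i, j, _, rfl⟩
    exact (take_prefix _ _).isInfix.trans (drop_suffix _ _).isInfix
  · rintro ⟨s, t, rfl⟩
    refine ⟨s.length, u.length, ⟨?_, ?_⟩, ?_⟩
    · grind
    · grind
    · simp

theorem infix_concat {w u : List A} {z : A} (h : u <:+: w ++ [z]) : u <:+: w ∨ u <:+ w ++ [z] := by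
  obtain ⟨s, t, h⟩ := h
  rcases List.eq_nil_or_concat t with rfl | ⟨t', y, rfl⟩
  · right; exact ⟨s, by simpa using h⟩
  · left
    refine ⟨s, t', ?_⟩
    have h' : (s ++ u ++ t') ++ [y] = w ++ [z] := by simpa using h
    exact (List.append_inj' h' rfl).1

theorem infix_of_prefix_ne_suffix_concat {w q s : List A} {z : A} (hq : q <:+ w ++ [z])
    (hs : s <+: q) (hne : s.length < q.length) : s <:+: w := by
  obtain ⟨t, rfl⟩ := hs
  obtain ⟨r, hr⟩ := hq
  rcases List.eq_nil_or_concat t with rfl | ⟨t', y, rfl⟩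
  · simp at hne
  · refine ⟨r, t', ?_⟩
    have : (r ++ s ++ t') ++ [y] = w ++ [z] := by simpa using hr
    exact (List.append_inj' this rfl).1

theorem exists_lps (w : List A) : ∃ q, q <:+ w ∧ q.reverse = q ∧
    ∀ q', q' <:+ w → q'.reverse = q' → q'.length ≤ q.length := by
  induction w with
  | nil => exact ⟨[], by simp⟩
  | cons x w ih =>
    by_cases h : (x :: w).reverse = x :: w
    · exact ⟨_, suffix_rfl, h, fun q' hq' _ => hq'.length_le⟩
    · obtain ⟨q, h1, h2, h3⟩ := ih
      refine ⟨q, h1.trans (suffix_cons _ _), h2, fun q' hq' hp => ?_⟩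
      rcases List.suffix_cons_iff.1 hq' with rfl | h'
      · exact absurd hp h
      · exact h3 _ h' hp

def npal (w : List A) : ℕ := ((factors w).filter (fun u => u.reverse = u)).card

theorem npal_concat {w q : List A} {z : A} (hq : q <:+ w ++ [z]) (hp : q.reverse = q)
    (hm : ∀ q', q' <:+ w ++ [z] → q'.reverse = q' → q'.length ≤ q.length) :
    npal (w ++ [z]) = npal w + if q <:+: w then 0 else 1 := by
  have key : (factors (w ++ [z])).filter (fun u => u.reverse = u) =
      insert q ((factors w).filter (fun u => u.reverse = u)) := by
    ext u
    simp only [Finset.mem_filter, mem_factors, Finset.mem_insert]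
    constructor
    · rintro ⟨h1, h2⟩
      rcases infix_concat h1 with h | h
      · exact Or.inr ⟨h, h2⟩
      · have hl := hm u h h2
        have hsuf : u <:+ q := List.suffix_of_suffix_length_le h hq hl
        rcases hl.lt_or_eq with hlt | heq
        · right
          refine ⟨infix_of_prefix_ne_suffix_concat hq ?_ hlt, h2⟩
          have := List.reverse_prefix.2 hsuf
          rwa [h2, hp] at this
        · left; exact hsuf.eq_of_length heq
    · rintro (rfl | ⟨h1, h2⟩)
      · exact ⟨hq.isInfix, hp⟩
      · exact ⟨h1.trans (prefix_append _ _).isInfix, h2⟩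
  unfold npal
  rw [key]
  split_ifs with h
  · rw [Finset.insert_eq_of_mem]; · rfl
    simp [mem_factors, h, hp]
  · rw [Finset.card_insert_of_notMem]
    simp [mem_factors, h]

theorem npal_nil : npal ([] : List A) = 1 := by
  have : (factors ([] : List A)).filter (fun u => u.reverse = u) = {[]} := by
    ext u; simp only [Finset.mem_filter, mem_factors, Finset.mem_singleton, infix_nil]
    constructor
    · exact fun h => h.1
    · rintro rfl; simp
  unfold npal; rw [this]; rfl

theorem npal_le (w : List A) : npal w ≤ w.length + 1 := by
  induction w using List.reverseRecOn with
  | nil => simp [npal_nil]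
  | append_singleton w z ih =>
    obtain ⟨q, h1, h2, h3⟩ := exists_lps (w ++ [z])
    rw [npal_concat h1 h2 h3]
    simp only [length_append, length_singleton]
    split_ifs <;> omega

theorem rich_iff (w : List A) : Rich w ↔ npal w = w.length + 1 := Iff.rfl

theorem rich_nil : Rich ([] : List A) := by
  rw [rich_iff, npal_nil]; rfl

theorem rich_concat_iff {w q : List A} {z : A} (hq : q <:+ w ++ [z]) (hp : q.reverse = q)
    (hm : ∀ q', q' <:+ w ++ [z] → q'.reverse = q' → q'.length ≤ q.length) :
    Rich (w ++ [z]) ↔ Rich w ∧ ¬ q <:+: w := by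
  rw [rich_iff, rich_iff, npal_concat hq hp hm]
  have := npal_le w
  simp only [length_append, length_singleton]
  split_ifs with h
  · simp [h]; omega
  · simp [h]

theorem Rich_of_pre_app {w u : List A} (h : Rich (w ++ u)) : Rich w := by
  induction u using List.reverseRecOn with
  | nil => simpa using h
  | append_singleton u z ih =>
    obtain ⟨q, h1, h2, h3⟩ := exists_lps ((w ++ u) ++ [z])
    rw [← append_assoc, rich_concat_iff h1 h2 h3] at h
    exact ih h.1

theorem factors_reverse (w : List A) : factors w.reverse = (factors w).image List.reverse := by
  ext u
  simp only [mem_factors, Finset.mem_image]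
  constructor
  · intro h
    exact ⟨u.reverse, by rw [← List.reverse_infix]; simpa using h, by simp⟩
  · rintro ⟨a, h, rfl⟩
    exact List.reverse_infix.2 h

theorem npal_reverse (w : List A) : npal w.reverse = npal w := by
  unfold npal
  congr 1
  ext u
  simp only [Finset.mem_filter, mem_factors]
  constructor <;> rintro ⟨h1, h2⟩ <;> refine ⟨?_, h2⟩
  · rw [← List.reverse_infix, h2]; exact h1
  · rw [← List.reverse_infix, h2] at h1; exact h1

theorem rich_reverse (w : List A) : Rich w.reverse ↔ Rich w := by
  rw [rich_iff, rich_iff, npal_reverse, length_reverse]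

theorem Rich_of_factor {w u : List A} (h : Rich w) (hu : u <:+: w) : Rich u := by
  obtain ⟨s, t, rfl⟩ := hu
  have h1 := Rich_of_pre_app h
  rw [← rich_reverse, reverse_append] at h1
  exact (rich_reverse u).1 (Rich_of_pre_app h1)

theorem Rich.letter_return {w u : List A} {x : A} (h : Rich w) (hu : x :: u ++ [x] <:+: w)
    (hx : x ∉ u) : u.reverse = u := by
  have h1 := Rich_of_factor h hu
  obtain ⟨q, hq1, hq2, hq3⟩ := exists_lps ((x :: u) ++ [x])
  rw [rich_concat_iff hq1 hq2 hq3] at h1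
  have hlen : 1 ≤ q.length := by
    simpa using hq3 [x] ⟨x :: u, rfl⟩ (by simp)
  obtain ⟨r, hr⟩ := hq1
  cases r with
  | nil =>
    rw [nil_append] at hr
    rw [hr] at hq2
    simpa using hq2
  | cons y r =>
    exfalso
    rcases List.eq_nil_or_concat q with rfl | ⟨q', z, rfl⟩
    · simp at hlen
    · have h2 : (y :: r ++ q') ++ [z] = (x :: u) ++ [x] := by simpa using hr
      obtain ⟨h3, h4⟩ := List.append_inj' h2 rfl
      simp only [cons_append, cons.injEq] at h3 h4
      obtain ⟨-, rfl⟩ := h3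
      obtain ⟨rfl, -⟩ := h4
      cases q' with
      | nil =>
        apply h1.2
        refine ⟨[], r, ?_⟩
        simp
      | cons a q'' =>
        simp at hq2
        apply hx; simp [hq2.1]

/-- `c` is a complete return to `q`. -/
def CR (c q : List A) : Prop :=
  q <+: c ∧ q <:+ c ∧ q.length < c.length ∧ ∀ s t, c = s ++ q ++ t → s = [] ∨ t = []

theorem rich_of_cr {w : List A}
    (h : ∀ c q, c <:+: w → CR c q → q ≠ [] → q.reverse = q → c.reverse = c) : Rich w := by
  induction w using List.reverseRecOn with
  | nil => exact rich_nil
  | append_singleton w z ih =>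
    have ih' := ih (fun c q hc => h c q (hc.trans (prefix_append _ _).isInfix))
    obtain ⟨q, hq1, hq2, hq3⟩ := exists_lps (w ++ [z])
    rw [rich_concat_iff hq1 hq2 hq3]
    refine ⟨ih', fun hinf => ?_⟩
    have hlen : 1 ≤ q.length := by
      simpa using hq3 [z] ⟨w, rfl⟩ (by simp)
    have hex : ∃ n, ∃ s t, w = s ++ q ++ t ∧ t.length = n := by
      obtain ⟨s, t, hst⟩ := hinf
      exact ⟨_, s, t, hst.symm, rfl⟩
    classical
    obtain ⟨s, t, hst, htn⟩ := Nat.find_spec hex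
    have hmin := fun m => Nat.find_min hex (m := m)
    rw [← htn] at hmin
    have hc : q ++ t ++ [z] <:+ w ++ [z] := ⟨s, by simp [hst]⟩
    have hqc : q <:+ q ++ t ++ [z] := List.suffix_of_suffix_length_le hq1 hc (by simp)
    have hcr : CR (q ++ t ++ [z]) q := by
      refine ⟨⟨t ++ [z], by simp⟩, hqc, by simp, fun s' t' he => ?_⟩
      by_contra hcon
      push Not at hcon
      obtain ⟨hs', ht'⟩ := hcon
      rcases List.eq_nil_or_concat t' with rfl | ⟨t'', y, rfl⟩
      · exact ht' rfl
      · have h1 : (q ++ t) ++ [z] = (s' ++ q ++ t'') ++ [y] := by simpa using he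
        have h2 := (List.append_inj' h1 rfl).1
        refine hmin t''.length ?_ ⟨s ++ s', t'', ?_, rfl⟩
        · have := congrArg List.length h2
          have h3 : 0 < s'.length := List.length_pos_iff.2 hs'
          simp at this; omega
        · rw [hst, append_assoc, h2]; simp
    have := h _ q hc.isInfix hcr (by rintro rfl; simp at hlen) hq2
    have := hq3 _ hc this
    simp at this

theorem infix_append_right {q v w : List A} (h : q <:+: v ++ w) (hq : ∀ x ∈ q, x ∉ v) :
    q <:+: w := by
  induction v with
  | nil => simpa using h
  | cons y v ih =>
    apply ih _ (fun x hx => by have := hq x hx; simp at this; exact this.2)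
    rw [cons_append, List.infix_cons_iff] at h
    rcases h with h | h
    · cases q with
      | nil => simp
      | cons a q =>
        rw [List.cons_prefix_cons] at h
        have := hq a (by simp)
        simp [h.1] at this
    · exact h

theorem infix_append_left {q v w : List A} (h : q <:+: v ++ w) (hq : ∀ x ∈ q, x ∉ w) :
    q <:+: v := by
  rw [← List.reverse_infix, reverse_append] at h
  rw [← List.reverse_infix]
  exact infix_append_right h (by simpa using hq)

theorem rich_append {v w : List A} (hv : Rich v) (hw : Rich w) (hd : ∀ x ∈ v, x ∉ w) :
    Rich (v ++ w) := by
  induction w using List.reverseRecOn with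
  | nil => simpa using hv
  | append_singleton w z ih =>
    have ih' := ih (Rich_of_pre_app hw) (fun x hx => by have := hd x hx; simp at this; exact this.1)
    obtain ⟨q, hq1, hq2, hq3⟩ := exists_lps ((v ++ w) ++ [z])
    have hzv : z ∉ v := fun h => by have := hd z h; simp at this
    have hlen : 1 ≤ q.length := by
      simpa using hq3 [z] ⟨v ++ w, rfl⟩ (by simp)
    have hsuf : q <:+ w ++ [z] := by
      rw [append_assoc] at hq1
      rcases Nat.le_total q.length (w ++ [z]).length with hle | hle
      · exact List.suffix_of_suffix_length_le hq1 (suffix_append _ _) hle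
      · have h2 : w ++ [z] <:+ q := List.suffix_of_suffix_length_le (suffix_append _ _) hq1 hle
        have h3 : z :: w.reverse <+: q := by
          have := List.reverse_prefix.2 h2
          rw [hq2] at this; simpa using this
        obtain ⟨r, hr⟩ := hq1
        obtain ⟨r2, hr2⟩ := h3
        have : r = v ∨ (v.length > r.length) := by
          have := congrArg List.length hr
          simp at this hle
          rcases Nat.lt_or_ge r.length v.length with h | h
          · exact Or.inr h
          · left
            exact (List.append_inj hr (by omega)).1
        rcases this with rfl | hgt
        · rw [List.append_cancel_left hr]
        · exfalso
          apply hzv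
          rw [← hr2, cons_append] at hr
          have h5 : (r ++ z :: (w.reverse ++ r2)).take v.length = v := by
            rw [hr]; simp
          rw [← h5]
          rw [List.take_append, List.mem_append]
          right
          have : v.length - r.length = (v.length - r.length - 1) + 1 := by omega
          rw [this, List.take_succ_cons]; simp
    have hm : ∀ q', q' <:+ w ++ [z] → q'.reverse = q' → q'.length ≤ q.length := by
      intro q' h1 h2
      apply hq3 _ _ h2
      rw [append_assoc]; exact h1.trans (suffix_append _ _)
    rw [rich_concat_iff hsuf hq2 hm] at hw
    rw [← append_assoc, rich_concat_iff hq1 hq2 hq3]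
    refine ⟨ih', fun hc => hw.2 (infix_append_right hc ?_)⟩
    intro x hx hxv
    exact hd x hxv (hsuf.subset hx)

theorem rich_singleton (x : A) : Rich [x] := by
  have := rich_concat_iff (w := []) (q := [x]) (z := x) (by simp) (by simp)
    (fun q' h _ => by simpa using h.length_le)
  rw [nil_append] at this
  rw [this]; exact ⟨rich_nil, by simp⟩

theorem rich_nodup {v : List A} (h : v.Nodup) : Rich v := by
  induction v with
  | nil => exact rich_nil
  | cons x v ih =>
    rw [nodup_cons] at h
    exact rich_append (v := [x]) (rich_singleton x) (ih h.2) (by simpa using h.1)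


def FF (w : List A) (n : ℕ) : Finset (List A) := (factors w).filter (fun u => u.length = n)

theorem mem_FF {w u : List A} {n : ℕ} : u ∈ FF w n ↔ u <:+: w ∧ u.length = n := by
  simp [FF, mem_factors]

theorem C_eq (w : List A) (n : ℕ) : C w n = (FF w n).card := rfl

theorem C_reverse (w : List A) (n : ℕ) : C w.reverse n = C w n := by
  rw [C_eq, C_eq, ← Finset.card_image_of_injective (FF w n) List.reverse_injective]
  congr 1
  ext u
  simp only [Finset.mem_image, mem_FF]
  constructor
  · rintro ⟨h1, h2⟩
    exact ⟨u.reverse, ⟨by rw [← List.reverse_infix]; simpa using h1, by simpa using h2⟩, by simp⟩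
  · rintro ⟨a, ⟨h1, h2⟩, rfl⟩
    exact ⟨List.reverse_infix.2 h1, by simpa using h2⟩

theorem suffix_eq_drop {u w : List A} (h : u <:+ w) : u = w.drop (w.length - u.length) :=
  List.suffix_iff_eq_drop.1 h

theorem C_concat {v : List A} {z : A} (hz : z ∉ v) {n : ℕ} (h1 : 1 ≤ n) (h2 : n ≤ v.length + 1) :
    C (v ++ [z]) n = C v n + 1 := by
  have hl : ((v ++ [z]).drop (v.length + 1 - n)).length = n := by
    simp; omega
  have key : FF (v ++ [z]) n = insert ((v ++ [z]).drop (v.length + 1 - n)) (FF v n) := by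
    ext u
    simp only [Finset.mem_insert, mem_FF]
    constructor
    · rintro ⟨h, hn⟩
      rcases infix_concat h with h | h
      · exact Or.inr ⟨h, hn⟩
      · left
        have := suffix_eq_drop h
        rw [hn] at this
        simpa using this
    · rintro (rfl | ⟨h, hn⟩)
      · exact ⟨(drop_suffix _ _).isInfix, hl⟩
      · exact ⟨h.trans (prefix_append _ _).isInfix, hn⟩
  rw [C_eq, C_eq, key, Finset.card_insert_of_notMem]
  rw [mem_FF]
  rintro ⟨h, -⟩
  apply hz
  apply h.subset
  rw [List.drop_append_of_le_length (by omega)]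
  simp

/-- The property of the complexity that is used. -/
def DD (w : List A) : Prop := ∀ n, 1 ≤ n → n ≤ w.length → C w (n + 1) ≤ C w n + 1 ∧
  (C w (n + 1) = C w n + 1 → ∀ i, 1 ≤ i → i ≤ n → C w (i + 1) = C w i + 1)

theorem DD_of_concat {v : List A} {z : A} (hz : z ∉ v) (h : DD (v ++ [z])) : DD v := by
  intro n h1 h2
  have := h n h1 (by simp; omega)
  rw [C_concat hz (by omega) (by omega), C_concat hz (by omega) (by omega)] at this
  refine ⟨by omega, fun he i hi1 hi2 => ?_⟩
  have h3 := this.2 (by omega) i hi1 hi2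
  rw [C_concat hz (by omega) (by omega), C_concat hz (by omega) (by omega)] at h3
  omega

theorem DD_reverse {v : List A} (h : DD v) : DD v.reverse := by
  intro n h1 h2
  simp only [C_reverse]
  exact h n h1 (by simpa using h2)

theorem DD_of_cons {v : List A} {z : A} (hz : z ∉ v) (h : DD (z :: v)) : DD v := by
  have h1 := DD_reverse h
  rw [reverse_cons] at h1
  have := DD_reverse (DD_of_concat (by simpa using hz) h1)
  simpa using this

theorem C_pos {w : List A} {n : ℕ} (h : n ≤ w.length) : 1 ≤ C w n := by
  rw [C_eq, Nat.one_le_iff_ne_zero, Finset.card_ne_zero]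
  exact ⟨w.take n, mem_FF.2 ⟨(take_prefix _ _).isInfix, by simpa using h⟩⟩

theorem DD_of_GT {w : List A} (h : IsGT w) : DD w := by
  obtain ⟨hne, h | ⟨m, M, hm, hmM, h1, h2, h3⟩⟩ := h
  · obtain ⟨a, ha⟩ := Finset.card_eq_one.1 h
    have hw : ∀ x ∈ w, x = a := by
      intro x hx
      have : x ∈ Alph w := by simpa [Alph] using hx
      rw [ha] at this; simpa using this
    have hC : ∀ n, C w n ≤ 1 := by
      intro n
      rw [C_eq, Finset.card_le_one]
      have : ∀ u ∈ FF w n, u = replicate n a := by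
        intro u hu
        rw [mem_FF] at hu
        rw [List.eq_replicate_iff]
        exact ⟨hu.2, fun b hb => hw b (hu.1.subset hb)⟩
      intro u hu u' hu'
      rw [this u hu, this u' hu']
    intro n hn1 hn2
    have e1 := hC (n+1)
    have e2 := C_pos hn2
    exact ⟨by omega, fun he => by omega⟩
  · intro n hn1 hn2
    have hlt : ∀ i, 1 ≤ i → i < m → C w (i+1) = C w i + 1 := by
      intro i hi him
      rw [h1 i hi (by omega), h1 (i+1) (by omega) (by omega)]; omega
    rcases Nat.lt_or_ge n m with hnm | hnm
    · exact ⟨by rw [hlt n hn1 hnm], fun _ i hi hin => hlt i hi (by omega)⟩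
    · rcases Nat.lt_or_ge n M with hnM | hnM
      · have := h2 n hnm (by omega)
        exact ⟨by omega, fun he => by omega⟩
      · have := h3 n hnM hn2
        exact ⟨by omega, fun he => by omega⟩

/-! Right valences. -/

def rset (w u : List A) : Finset A := (Alph w).filter (fun x => u ++ [x] <:+: w)

theorem mem_rset {w u : List A} {x : A} : x ∈ rset w u ↔ u ++ [x] <:+: w := by
  simp only [rset, Alph, Finset.mem_filter, List.mem_toFinset, and_iff_right_iff_imp]
  intro h
  exact h.subset (by simp)

theorem sum_rset (w : List A) (n : ℕ) : ∑ u ∈ FF w n, (rset w u).card = C w (n + 1) := by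
  rw [C_eq, Finset.card_eq_sum_card_fiberwise (f := List.dropLast) (t := FF w n)]
  · apply Finset.sum_congr rfl
    intro u hu
    rw [← Finset.card_image_of_injective (rset w u) (f := fun x => u ++ [x])
      (fun x y h => by simpa using h)]
    congr 1
    ext g
    simp only [Finset.mem_image, Finset.mem_filter, mem_FF, mem_rset]
    rw [mem_FF] at hu
    constructor
    · rintro ⟨x, h1, rfl⟩
      exact ⟨⟨h1, by simp [hu.2]⟩, by simp⟩
    · rintro ⟨⟨h1, h2⟩, rfl⟩
      have hg : g ≠ [] := by rintro rfl; simp at h2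
      exact ⟨g.getLast hg, by rwa [List.dropLast_append_getLast], by rw [List.dropLast_append_getLast]⟩
  · intro g hg
    have hg' := mem_FF.1 (Finset.mem_coe.1 hg)
    apply Finset.mem_coe.2
    exact mem_FF.2 ⟨(List.dropLast_prefix g).isInfix.trans hg'.1, by simp [hg'.2]⟩

def SS (w : List A) (n : ℕ) : ℕ := ∑ u ∈ FF w n, ((rset w u).card - 1)

/-- The suffix of length `n` can be extended to the right somewhere. -/
def EE (w : List A) (n : ℕ) : Prop := ∃ x, w.drop (w.length - n) ++ [x] <:+: w

open Classical in
theorem C_succ {w : List A} {n : ℕ} (hn : n ≤ w.length) :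
    C w (n + 1) + (if EE w n then 0 else 1) = C w n + SS w n := by
  have h0 : ((FF w n).filter (fun u => (rset w u).card = 0)).card = if EE w n then 0 else 1 := by
    have hsuf : ∀ u ∈ FF w n, (rset w u).card = 0 → u = w.drop (w.length - n) := by
      intro u hu h
      rw [mem_FF] at hu
      obtain ⟨⟨s, t, hst⟩, hl⟩ := hu
      cases t with
      | nil =>
        have := suffix_eq_drop (u := u) (w := w) ⟨s, by simpa using hst⟩
        rwa [hl] at this
      | cons y t =>
        rw [Finset.card_eq_zero] at h
        have : y ∈ rset w u := mem_rset.2 ⟨s, t, by simpa using hst⟩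
        rw [h] at this; simp at this
    split_ifs with hE
    · rw [Finset.card_eq_zero, Finset.filter_eq_empty_iff]
      intro u hu h
      have h' := hsuf u hu h
      obtain ⟨x, hx⟩ := hE
      rw [← h'] at hx
      rw [Finset.card_eq_zero] at h
      have := mem_rset.2 hx
      rw [h] at this; simp at this
    · rw [Finset.card_eq_one]
      refine ⟨w.drop (w.length - n), ?_⟩
      ext u
      simp only [Finset.mem_filter, Finset.mem_singleton]
      constructor
      · rintro ⟨h1, h2⟩; exact hsuf u h1 h2
      · rintro rfl
        refine ⟨mem_FF.2 ⟨(drop_suffix _ _).isInfix, by simp; omega⟩, ?_⟩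
        rw [Finset.card_eq_zero, Finset.eq_empty_iff_forall_notMem]
        intro x hx
        exact hE ⟨x, mem_rset.1 hx⟩
  rw [← h0, ← sum_rset, Finset.card_filter, ← Finset.sum_add_distrib, C_eq, Finset.card_eq_sum_ones,
    SS, ← Finset.sum_add_distrib]
  apply Finset.sum_congr rfl
  intro u _
  split_ifs <;> omega

theorem SS_ge_one {w u : List A} {n : ℕ} (h : u ∈ FF w n) : (rset w u).card - 1 ≤ SS w n :=
  Finset.single_le_sum (f := fun u => (rset w u).card - 1) (fun _ _ => Nat.zero_le _) h

theorem SS_ge_two {w u u' : List A} {n : ℕ} (h : u ∈ FF w n) (h' : u' ∈ FF w n) (hne : u ≠ u') :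
    ((rset w u).card - 1) + ((rset w u').card - 1) ≤ SS w n := by
  rw [← Finset.sum_pair (f := fun u => (rset w u).card - 1) hne]
  apply Finset.sum_le_sum_of_subset
  intro x hx
  simp at hx
  rcases hx with rfl | rfl <;> assumption

theorem two_le_rset {w u : List A} {x y : A} (hx : u ++ [x] <:+: w) (hy : u ++ [y] <:+: w)
    (hne : x ≠ y) : 2 ≤ (rset w u).card :=
  Finset.one_lt_card.2 ⟨x, mem_rset.2 hx, y, mem_rset.2 hy, hne⟩

theorem three_le_rset {w u : List A} {x y z : A} (hx : u ++ [x] <:+: w) (hy : u ++ [y] <:+: w)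
    (hz : u ++ [z] <:+: w) (hne : x ≠ y) (h2 : x ≠ z) (h3 : y ≠ z) : 3 ≤ (rset w u).card :=
  Finset.two_lt_card.2 ⟨x, mem_rset.2 hx, y, mem_rset.2 hy, z, mem_rset.2 hz, hne, h2, h3⟩

theorem left_infix {w u t : List A} (h : u ++ t <:+: w) : u <:+: w :=
  (prefix_append u t).isInfix.trans h

theorem right_infix {w u t : List A} (h : u ++ t <:+: w) : t <:+: w :=
  (suffix_append u t).isInfix.trans h

theorem EE_mono {w : List A} {m n : ℕ} (h : EE w n) (hmn : m ≤ n) : EE w m := by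
  obtain ⟨x, hx⟩ := h
  refine ⟨x, IsInfix.trans ?_ hx⟩
  have : w.drop (w.length - m) <:+ w.drop (w.length - n) := by
    rw [show w.length - m = (w.length - n) + ((w.length - m) - (w.length - n)) by omega, ← drop_drop]
    exact drop_suffix _ _
  obtain ⟨s, hs⟩ := this
  exact ⟨s, [], by rw [← hs]; simp⟩

/-- Right degree condition on letters. -/
def RD (v : List A) : Prop :=
  (∀ x y a b c d : A, [x, a] <:+: v → [x, b] <:+: v → [y, c] <:+: v → [y, d] <:+: v →
    a ≠ b → c ≠ d → x = y) ∧
  (∀ x a b c : A, [x, a] <:+: v → [x, b] <:+: v → [x, c] <:+: v → a = b ∨ a = c ∨ b = c)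

/-- No strong bispecial nonempty factor. -/
def NS (v : List A) : Prop :=
  ∀ (u : List A) (x y s t : A), u ≠ [] → x ≠ y → s ≠ t → x :: (u ++ [s]) <:+: v →
    x :: (u ++ [t]) <:+: v → y :: (u ++ [s]) <:+: v → y :: (u ++ [t]) <:+: v → False

/-- The last letter is repeated. -/
def LR (v : List A) : Prop := ∃ (s : List A) (x : A), x ∈ s ∧ v = s ++ [x]

theorem EE_one {s : List A} {x : A} (h : x ∈ s) : EE (s ++ [x]) 1 := by
  obtain ⟨s1, s2, rfl⟩ := List.append_of_mem h
  unfold EE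
  have : (s1 ++ x :: s2 ++ [x]).drop ((s1 ++ x :: s2 ++ [x]).length - 1) = [x] := by
    rw [show (s1 ++ x :: s2 ++ [x]).length - 1 = (s1 ++ x :: s2).length by simp]
    exact List.drop_left
  rw [this]
  cases s2 with
  | nil => exact ⟨x, s1, [], by simp⟩
  | cons y s2 => exact ⟨y, s1, s2 ++ [x], by simp⟩

theorem SS_one {s : List A} {x : A} (h : x ∈ s) (hD : DD (s ++ [x])) : SS (s ++ [x]) 1 ≤ 1 := by
  have h1 := C_succ (w := s ++ [x]) (n := 1) (by simp)
  rw [if_pos (EE_one h)] at h1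
  have := (hD 1 le_rfl (by simp)).1
  omega

theorem RD_of_SS {v : List A} (h : SS v 1 ≤ 1) : RD v := by
  constructor
  · intro x y a b c d h1 h2 h3 h4 h5 h6
    by_contra hne
    have e1 := two_le_rset (u := [x]) h1 h2 h5
    have e2 := two_le_rset (u := [y]) h3 h4 h6
    have := SS_ge_two (w := v) (u := [x]) (u' := [y]) (n := 1)
      (mem_FF.2 ⟨left_infix (u := [x]) (t := [a]) h1, rfl⟩)
      (mem_FF.2 ⟨left_infix (u := [y]) (t := [c]) h3, rfl⟩) (by simpa using hne)
    omega
  · intro x a b c h1 h2 h3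
    by_contra hcon
    push Not at hcon
    have e1 := three_le_rset (u := [x]) h1 h2 h3 hcon.1 hcon.2.1 hcon.2.2
    have := SS_ge_one (w := v) (u := [x]) (n := 1) (mem_FF.2 ⟨left_infix (u := [x]) (t := [a]) h1, rfl⟩)
    omega


def win (v : List A) (i n : ℕ) : List A := (v.drop i).take n

theorem win_infix (v : List A) (i n : ℕ) : win v i n <:+: v :=
  (take_prefix _ _).isInfix.trans (drop_suffix _ _).isInfix

theorem win_length {v : List A} {i n : ℕ} (h : i + n ≤ v.length) : (win v i n).length = n := by
  simp [win]; omega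

theorem exists_win {v u : List A} (h : u <:+: v) : ∃ i, i + u.length ≤ v.length ∧
    win v i u.length = u := by
  obtain ⟨s, t, rfl⟩ := h
  exact ⟨s.length, by simp, by simp [win]⟩

theorem win_succ_left {v : List A} {i n : ℕ} (h : i < v.length) :
    win v i (n + 1) = v[i] :: win v (i + 1) n := by
  unfold win
  rw [List.drop_eq_getElem_cons h, List.take_succ_cons]

theorem win_succ_right {v : List A} {i n : ℕ} (h : i + n < v.length) :
    win v i (n + 1) = win v i n ++ [v[i + n]] := by
  unfold win
  rw [List.take_succ_eq_append_getElem (by simp; omega)]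
  simp

theorem win_take {v : List A} {i n : ℕ} (h : i < v.length) :
    win v i n = (v[i] :: win v (i + 1) n).take n := by
  rw [← win_succ_left h]
  simp [win, List.take_take]

theorem LS_unique {v u u0 : List A} {k k' x y : A} {N : ℕ} (hT : SS v.reverse N ≤ 1)
    (hu : u.length = N) (hu0 : u0.length = N) (hk : k :: u <:+: v) (hk' : k' :: u <:+: v)
    (hx : x :: u0 <:+: v) (hy : y :: u0 <:+: v) (hkk : k ≠ k') (hxy : x ≠ y) : u = u0 := by
  by_contra hne
  rw [← List.reverse_infix, reverse_cons] at hk hk' hx hy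
  have e1 := two_le_rset hk hk' hkk
  have e2 := two_le_rset hx hy hxy
  have := SS_ge_two (w := v.reverse) (u := u.reverse) (u' := u0.reverse) (n := N)
    (mem_FF.2 ⟨left_infix hk, by simpa using hu⟩) (mem_FF.2 ⟨left_infix hx, by simpa using hu0⟩)
    (by simpa using hne)
  omega

theorem LS_two {v u : List A} {k x y : A} {N : ℕ} (hT : SS v.reverse N ≤ 1)
    (hu : u.length = N) (hk : k :: u <:+: v)
    (hx : x :: u <:+: v) (hy : y :: u <:+: v) (hxy : x ≠ y) : k = x ∨ k = y := by
  by_contra hcon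
  push Not at hcon
  rw [← List.reverse_infix, reverse_cons] at hk hx hy
  have e1 := three_le_rset hk hx hy hcon.1 hcon.2 hxy
  have := SS_ge_one (w := v.reverse) (u := u.reverse) (n := N)
    (mem_FF.2 ⟨left_infix hk, by simpa using hu⟩)
  omega

theorem strong_of_SS {v : List A} {N : ℕ} (hS1 : SS v N ≤ 1) (hS2 : SS v (N + 1) = 2) :
    ∃ (u : List A) (x y a b : A), u.length = N ∧ x ≠ y ∧ a ≠ b ∧ x :: u ++ [a] <:+: v ∧
      x :: u ++ [b] <:+: v ∧ y :: u ++ [a] <:+: v ∧ y :: u ++ [b] <:+: v := by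
  have hex : ∃ g ∈ FF v (N+1), (rset v g).card - 1 ≠ 0 :=
    Finset.exists_ne_zero_of_sum_ne_zero (by
      change SS v (N+1) ≠ 0; omega)
  obtain ⟨g1, hg1, hc1⟩ := hex
  have key : ∀ g ∈ FF v (N+1), (rset v g).card - 1 ≠ 0 → ∃ x u, g = x :: u ∧ u ∈ FF v N ∧
      (rset v g).card = 2 ∧ (rset v u).card = 2 ∧ rset v g = rset v u := by
    intro g hg hc
    have hg' := mem_FF.1 hg
    cases g with
    | nil => simp at hg'
    | cons x u =>
      have hu : u ∈ FF v N := mem_FF.2 ⟨right_infix (u := [x]) hg'.1, by simpa using hg'.2⟩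
      have hsub : rset v (x :: u) ⊆ rset v u := by
        intro z hz
        rw [mem_rset] at hz ⊢
        exact right_infix (u := [x]) hz
      have e1 := Finset.card_le_card hsub
      have e2 := SS_ge_one hu
      refine ⟨x, u, rfl, hu, by omega, by omega, ?_⟩
      exact Finset.eq_of_subset_of_card_le hsub (by omega)
  obtain ⟨x, u, rfl, hu, h1, h2, h3⟩ := key g1 hg1 hc1
  have hex2 : ∃ g ∈ FF v (N+1), g ≠ x :: u ∧ (rset v g).card - 1 ≠ 0 := by
    by_contra hcon
    push Not at hcon
    have := Finset.sum_eq_single_of_mem (f := fun g => (rset v g).card - 1) _ hg1 hcon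
    change SS v (N+1) = _ at this
    omega
  obtain ⟨g2, hg2, hne, hc2⟩ := hex2
  obtain ⟨y, u', rfl, hu', h1', h2', h3'⟩ := key g2 hg2 hc2
  have huu : u' = u := by
    by_contra hne
    have := SS_ge_two hu' hu hne
    omega
  subst huu
  obtain ⟨a, b, hab, hset⟩ := Finset.card_eq_two.1 h2
  have hm : ∀ c, c = a ∨ c = b → c ∈ rset v u' := by
    intro c hc; rw [hset]; simpa using hc
  refine ⟨u', x, y, a, b, (mem_FF.1 hu).2, ?_, hab, ?_, ?_, ?_, ?_⟩
  · rintro rfl; exact hne rfl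
  · exact mem_rset.1 (h3 ▸ hm a (Or.inl rfl))
  · exact mem_rset.1 (h3 ▸ hm b (Or.inr rfl))
  · exact mem_rset.1 (h3' ▸ hm a (Or.inl rfl))
  · exact mem_rset.1 (h3' ▸ hm b (Or.inr rfl))

theorem core {v : List A} {N : ℕ} (hNv : N + 1 ≤ v.length) (hE : EE v N)
    (hnE : ¬ EE v (N + 1)) (hS1 : SS v N ≤ 1) (hS2 : SS v (N + 1) = 2)
    (hT : SS v.reverse N ≤ 1) : False := by
  obtain ⟨u, x, y, a, b, hul, hxy, hab, hxa, hxb, hya, hyb⟩ := strong_of_SS hS1 hS2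
  have hxu : x :: u <:+: v := left_infix hxa
  have hyu : y :: u <:+: v := left_infix hya
  -- the suffix `t` of length `N` and the preceding letter
  set e := v.length - (N + 1) with he
  have hend : v.drop (v.length - N) = win v (e + 1) N := by
    unfold win
    rw [List.take_of_length_le (by simp; omega)]
    congr 1; omega
  have hend' : v.drop (v.length - (N + 1)) = win v e (N + 1) := by
    unfold win
    rw [List.take_of_length_le (by simp; omega)]
  have hz := win_succ_left (v := v) (i := e) (n := N) (by omega)
  unfold EE at hE hnE
  rw [hend] at hE
  rw [hend', hz] at hnE
  set t := win v (e + 1) N with ht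
  set z := v[e]'(by omega) with hzdef
  have hzt : z :: t <:+: v := by rw [← hz]; exact win_infix _ _ _
  have htl : t.length = N := win_length (by omega)
  have htu : t ≠ u := by
    intro htu
    rw [htu] at hzt hnE
    rcases LS_two hT hul hzt hxu hyu hxy with h | h
    · exact hnE ⟨a, h ▸ hxa⟩
    · exact hnE ⟨a, h ▸ hya⟩
  -- any occurrence of `t` not at the end is at the start
  have honly : ∀ i, i + N < v.length → win v i N = t → i = 0 := by
    intro i hi hw
    by_contra h0
    obtain ⟨j, rfl⟩ : ∃ j, i = j + 1 := ⟨i - 1, by omega⟩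
    have h1 := win_succ_left (v := v) (i := j) (n := N) (by omega)
    have h2 := win_succ_right (v := v) (i := j) (n := N + 1) (by omega)
    have h4 : v[j]'(by omega) :: t <:+: v := by rw [← hw, ← h1]; exact win_infix _ _ _
    by_cases hzz : v[j]'(by omega) = z
    · apply hnE
      refine ⟨v[j + (N + 1)]'(by omega), ?_⟩
      rw [← hzz, ← hw, ← h1, ← h2]
      exact win_infix _ _ _
    · exact htu (LS_unique hT htl hul h4 hzt hxu hyu hzz hxy)
  have hzero : win v 0 N = t := by
    obtain ⟨c, hc⟩ := hE
    obtain ⟨i, hi1, hi2⟩ := exists_win hc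
    simp only [length_append, length_singleton, htl] at hi1 hi2
    rw [win_succ_right (by omega)] at hi2
    have h1 := (List.append_inj' hi2 rfl).1
    have := honly i (by omega) h1
    subst this; exact h1
  -- first occurrence of `u`
  have hexu : ∃ i, i + N ≤ v.length ∧ win v i N = u := by
    obtain ⟨i, hi1, hi2⟩ := exists_win (right_infix (u := [x]) hxu)
    rw [hul] at hi1 hi2
    exact ⟨i, hi1, hi2⟩
  classical
  obtain ⟨hi1, hi2⟩ := Nat.find_spec hexu
  have hmin := fun m => Nat.find_min hexu (m := m)
  set i0 := Nat.find hexu with hi0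
  have hi0pos : i0 ≠ 0 := by
    intro h; rw [h, hzero] at hi2; exact htu hi2
  obtain ⟨j0, hj0⟩ : ∃ j, i0 = j + 1 := ⟨i0 - 1, by omega⟩
  rw [hj0] at hi1 hi2 hmin
  have hx1 : v[j0]'(by omega) :: u <:+: v := by
    have h9 := win_succ_left (v := v) (i := j0) (n := N) (by omega)
    rw [hi2] at h9
    rw [← h9]; exact win_infix _ _ _
  set x1 := v[j0]'(by omega) with hx1def
  -- another occurrence
  have hoth : ∃ j, j0 < j ∧ ∃ h : j + 1 + N < v.length, win v (j + 1) N = u ∧ v[j] = x1 := by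
    have hocc : ∀ c, x1 :: u ++ [c] <:+: v → ∃ j, j0 ≤ j ∧ ∃ h : j + 1 + N < v.length,
        win v (j + 1) N = u ∧ v[j] = x1 ∧ v[j + 1 + N] = c := by
      intro c hc
      obtain ⟨j, hj1, hj2⟩ := exists_win hc
      simp only [length_append, length_cons, length_nil, Nat.zero_add, hul] at hj1 hj2
      rw [win_succ_left (by omega), win_succ_right (by omega)] at hj2
      simp only [cons_append, cons.injEq] at hj2
      have h3 := List.append_inj' hj2.2 rfl
      refine ⟨j, ?_, by omega, h3.1, hj2.1, by simpa using h3.2⟩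
      by_contra hlt
      exact hmin (j + 1) (by omega) ⟨by omega, h3.1⟩
    have hab' : x1 :: u ++ [a] <:+: v ∧ x1 :: u ++ [b] <:+: v := by
      rcases LS_two hT hul hx1 hxu hyu hxy with h | h <;> rw [h]
      · exact ⟨hxa, hxb⟩
      · exact ⟨hya, hyb⟩
    obtain ⟨j, hj, hjl, hjw, hjx, hjc⟩ := hocc a hab'.1
    obtain ⟨j', hj', hjl', hjw', hjx', hjc'⟩ := hocc b hab'.2
    by_cases hjj : j0 < j
    · exact ⟨j, hjj, hjl, hjw, hjx⟩
    · by_cases hjj' : j0 < j'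
      · exact ⟨j', hjj', hjl', hjw', hjx'⟩
      · exfalso
        have : j = j' := by omega
        subst this
        exact hab (hjc.symm.trans hjc')
  obtain ⟨j, hj, hjl, hjw, hjx⟩ := hoth
  have hback : ∀ s, s ≤ j0 → win v (j0 - s) N = win v (j - s) N := by
    intro s
    induction s with
    | zero =>
      intro _
      rw [Nat.sub_zero, Nat.sub_zero, win_take (by omega), win_take (i := j) (by omega), hi2, hjw, hjx]
    | succ s ih =>
      intro hs
      have ih' := ih (by omega)
      obtain ⟨k, hk⟩ : ∃ k, j0 - s = k + 1 := ⟨j0 - s - 1, by omega⟩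
      obtain ⟨k', hk'⟩ : ∃ k', j - s = k' + 1 := ⟨j - s - 1, by omega⟩
      rw [hk, hk'] at ih'
      rw [show j0 - (s + 1) = k by omega, show j - (s + 1) = k' by omega]
      rw [win_take (by omega), win_take (i := k') (by omega), ih']
      have hne : win v (k + 1) N ≠ u := fun h => hmin (k + 1) (by omega) ⟨by omega, h⟩
      have g1 : v[k]'(by omega) :: win v (k + 1) N <:+: v := by
        rw [← win_succ_left (by omega)]; exact win_infix _ _ _
      have g2 : v[k']'(by omega) :: win v (k + 1) N <:+: v := by
        rw [ih', ← win_succ_left (by omega)]; exact win_infix _ _ _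
      by_cases hkk : v[k]'(by omega) = v[k']'(by omega)
      · rw [hkk]
      · exact absurd (LS_unique hT (win_length (by omega)) hul g1 g2 hxu hyu hkk hxy) hne
  have hfin := hback j0 le_rfl
  rw [Nat.sub_self, hzero] at hfin
  have := honly (j - j0) (by omega) hfin.symm
  omega

theorem NS_of_DD {v : List A} (hD : DD v) (hR : LR v) (hL : LR v.reverse) : NS v := by
  intro u x y s t hu hxy hst h1 h2 h3 h4
  have hDr := DD_reverse hD
  have hE1 : EE v 1 := by
    obtain ⟨s, x, hx, rfl⟩ := hR; exact EE_one hx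
  have hE1' : EE v.reverse 1 := by
    obtain ⟨s, x, hx, h⟩ := hL; rw [h]; exact EE_one hx
  set n := u.length + 1 with hn
  have hul : 1 ≤ u.length := List.length_pos_iff.2 hu
  have hnv : n ≤ v.length := by
    have := h1.length_le
    simp at this; omega
  have hgen : ∀ w : List A, DD w → n ≤ w.length → 2 ≤ SS w n → ¬ EE w n ∧ ∀ i, 1 ≤ i → i ≤ n →
      C w (i + 1) = C w i + 1 := by
    intro w hw hl h2
    classical
    have e1 := C_succ hl
    have e2 := hw n (by omega) hl
    by_cases hE : EE w n
    · rw [if_pos hE] at e1; omega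
    · rw [if_neg hE] at e1
      exact ⟨hE, e2.2 (by omega)⟩
  have hS : 2 ≤ SS v n := by
    have e1 := two_le_rset (u := x :: u) h1 h2 hst
    have e2 := two_le_rset (u := y :: u) h3 h4 hst
    have := SS_ge_two (w := v) (u := x :: u) (u' := y :: u) (n := n)
      (mem_FF.2 ⟨left_infix (u := x :: u) (t := [s]) h1, rfl⟩)
      (mem_FF.2 ⟨left_infix (u := y :: u) (t := [s]) h3, rfl⟩) (by simpa using hxy)
    omega
  have hT : 2 ≤ SS v.reverse n := by
    rw [← List.reverse_infix] at h1 h2 h3 h4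
    simp only [reverse_cons, reverse_append, reverse_nil, nil_append, singleton_append] at h1 h2 h3 h4
    have e1 := two_le_rset h1 h3 hxy
    have e2 := two_le_rset h2 h4 hxy
    have := SS_ge_two (w := v.reverse) (u := s :: u.reverse) (u' := t :: u.reverse) (n := n)
      (mem_FF.2 ⟨left_infix h1, by simp [hn]⟩)
      (mem_FF.2 ⟨left_infix h2, by simp [hn]⟩) (by simpa using hst)
    omega
  obtain ⟨hEn, hCi⟩ := hgen v hD hnv hS
  obtain ⟨hEn', hCi'⟩ := hgen v.reverse hDr (by simpa using hnv) hT
  classical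
  have hval : ∀ w : List A, n ≤ w.length → (∀ i, 1 ≤ i → i ≤ n → C w (i + 1) = C w i + 1) →
      ∀ i, 1 ≤ i → i ≤ n → SS w i = if EE w i then 1 else 2 := by
    intro w hl h i hi1 hi2
    have e1 := C_succ (w := w) (n := i) (by omega)
    have e2 := h i hi1 hi2
    split_ifs at e1 ⊢ <;> omega
  have hvS := hval v hnv hCi
  have hvT := hval v.reverse (by simpa using hnv) hCi'
  have hex : ∃ k, 1 ≤ k ∧ (¬ EE v k ∨ ¬ EE v.reverse k) := ⟨n, by omega, Or.inl hEn⟩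
  obtain ⟨hK1, hK2⟩ := Nat.find_spec hex
  have hmin := fun m => Nat.find_min hex (m := m)
  have hKn : Nat.find hex ≤ n := Nat.find_min' hex ⟨by omega, Or.inl hEn⟩
  set K := Nat.find hex with hKdef
  have hKne : K ≠ 1 := by
    intro h; rw [h] at hK2
    rcases hK2 with h | h
    · exact h hE1
    · exact h hE1'
  obtain ⟨N, hN⟩ : ∃ N, K = N + 1 := ⟨K - 1, by omega⟩
  have hm := hmin N (by omega)
  push Not at hm
  have hm := hm (by omega)
  have a1 := hvS N (by omega) (by omega)
  have a2 := hvT N (by omega) (by omega)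
  rw [if_pos hm.1] at a1
  rw [if_pos hm.2] at a2
  rcases hK2 with h | h
  · have a3 := hvS K (by omega) (by omega)
    rw [if_neg h] at a3
    rw [hN] at a3 h
    exact core (by omega) hm.1 h (by omega) a3 (by omega)
  · have a3 := hvT K (by omega) (by omega)
    rw [if_neg h] at a3
    rw [hN] at a3 h
    exact core (v := v.reverse) (by simp; omega) hm.2 h (by omega) a3 (by rw [reverse_reverse]; omega)

theorem RD_of_DD {v : List A} (hD : DD v) (hR : LR v) : RD v := by
  obtain ⟨s, x, hx, rfl⟩ := hR
  exact RD_of_SS (SS_one hx hD)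


/-! ### Desubstitution -/

def pb (a x : A) : List A := if x = a then [a] else [a, x]

def psi (a : A) (V : List A) : List A := V.flatMap (pb a)

theorem pb_self (a : A) : pb a a = [a] := by simp [pb]

theorem pb_ne {a x : A} (h : x ≠ a) : pb a x = [a, x] := by simp [pb, h]

@[simp] theorem psi_nil (a : A) : psi a [] = [] := rfl

theorem psi_append (a : A) (U V : List A) : psi a (U ++ V) = psi a U ++ psi a V := by
  simp [psi, List.flatMap_append]

theorem psi_cons (a x : A) (V : List A) : psi a (x :: V) = pb a x ++ psi a V := by
  simp [psi]

theorem psi_cons_exists (a x : A) (V : List A) : ∃ t, psi a (x :: V) = a :: t := by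
  rw [psi_cons]
  by_cases h : x = a
  · subst h; exact ⟨psi x V, by simp [pb_self]⟩
  · exact ⟨x :: psi a V, by simp [pb_ne h]⟩

theorem psi_head (a : A) (V : List A) : ∃ t, psi a V ++ [a] = a :: t := by
  cases V with
  | nil => exact ⟨[], rfl⟩
  | cons x V =>
    obtain ⟨t, ht⟩ := psi_cons_exists a x V
    exact ⟨t ++ [a], by simp [ht]⟩

theorem psi_reverse (a : A) (V : List A) :
    (psi a V ++ [a]).reverse = psi a V.reverse ++ [a] := by
  induction V with
  | nil => rfl
  | cons x V ih =>
    rw [psi_cons, append_assoc, reverse_append, ih, reverse_cons, psi_append, psi_cons]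
    by_cases h : x = a
    · subst h; simp [pb_self]
    · simp [pb_ne h]

theorem psi_count (a : A) (V : List A) : (psi a V).count a = V.length := by
  induction V with
  | nil => rfl
  | cons x V ih =>
    rw [psi_cons, count_append, ih]
    by_cases h : x = a
    · subst h; simp [pb_self]; omega
    · simp [pb_ne h, h]; omega

theorem psi_length_ge (a : A) (V : List A) : V.length ≤ (psi a V).length := by
  rw [← psi_count a V]; exact count_le_length

theorem psi_prefix {a : A} {Q V : List A} (h : psi a Q ++ [a] <+: psi a V ++ [a]) : Q <+: V := by
  induction Q generalizing V with
  | nil => exact nil_prefix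
  | cons x Q ih =>
    cases V with
    | nil =>
      exfalso
      have h1 := h.length_le
      have h2 := psi_length_ge a (x :: Q)
      simp only [length_append, length_cons, length_nil, psi_nil] at h1 h2; omega
    | cons y V =>
      rw [psi_cons, psi_cons] at h
      obtain ⟨t1, ht1⟩ := psi_head a Q
      obtain ⟨t2, ht2⟩ := psi_head a V
      by_cases hx : x = a <;> by_cases hy : y = a
      · subst hx; subst hy
        simp only [pb_self, singleton_append, cons_append, prefix_cons_inj] at h
        simpa using ih h
      · subst hx
        simp only [pb_self, pb_ne hy, append_assoc, ht1, ht2] at h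
        simp at h
        exact absurd h.1.symm hy
      · subst hy
        simp only [pb_self, pb_ne hx, append_assoc, ht1, ht2] at h
        simp at h
        exact absurd h.1 hx
      · simp only [pb_ne hx, pb_ne hy, append_assoc, cons_append, nil_append, prefix_cons_inj] at h
        rw [cons_prefix_cons] at h
        rw [h.1]
        simpa using ih h.2

theorem psi_inj {a : A} {Q V : List A} (h : psi a Q ++ [a] = psi a V ++ [a]) : Q = V := by
  have h1 := psi_prefix (a := a) (Q := Q) (V := V) (by rw [h])
  have h2 := psi_prefix (a := a) (Q := V) (V := Q) (by rw [h])
  exact h1.eq_of_length_le h2.length_le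

theorem psi_suffix {a : A} {Q V : List A} (h : psi a Q ++ [a] <:+ psi a V ++ [a]) : Q <:+ V := by
  rw [← reverse_prefix, psi_reverse, psi_reverse] at h
  exact reverse_prefix.1 (psi_prefix h)

theorem psi_prefix_mono {a : A} {Q V : List A} (h : Q <+: V) :
    psi a Q ++ [a] <+: psi a V ++ [a] := by
  obtain ⟨r, rfl⟩ := h
  obtain ⟨t, ht⟩ := psi_head a r
  rw [psi_append, append_assoc, ht]
  exact ⟨t, by simp⟩

theorem psi_suffix_mono {a : A} {Q V : List A} (h : Q <:+ V) :
    psi a Q ++ [a] <:+ psi a V ++ [a] := by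
  obtain ⟨r, rfl⟩ := h
  rw [psi_append, append_assoc]
  exact suffix_append _ _

theorem psi_pal {a : A} {V : List A} :
    (psi a V ++ [a]).reverse = psi a V ++ [a] ↔ V.reverse = V := by
  rw [psi_reverse]
  exact ⟨fun h => psi_inj h, fun h => by rw [h]⟩

def star (a : A) (v : List A) : Prop := ∀ x y, [x, y] <:+: v → x = a ∨ y = a

theorem star_infix {a : A} {v c : List A} (h : star a v) (hc : c <:+: v) : star a c :=
  fun x y hxy => h x y (hxy.trans hc)

theorem star_reverse {a : A} {v : List A} (h : star a v) : star a v.reverse := by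
  intro x y hxy
  rw [← reverse_infix] at hxy
  simp at hxy
  exact (h _ _ hxy).symm

theorem exists_psi_aux (a : A) (n : ℕ) : ∀ t : List A, t.length ≤ n → star a (a :: t) →
    (a :: t).getLast? = some a → ∃ V, a :: t = psi a V ++ [a] := by
  induction n with
  | zero =>
    intro t ht _ _
    have : t = [] := by simpa using ht
    subst this; exact ⟨[], rfl⟩
  | succ n ih =>
    intro t ht hs hl
    cases t with
    | nil => exact ⟨[], rfl⟩
    | cons x t =>
      by_cases hx : x = a
      · subst hx
        obtain ⟨V, hV⟩ := ih t (by simpa using ht) (star_infix hs (suffix_cons _ _).isInfix)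
          (by simpa using hl)
        exact ⟨x :: V, by rw [psi_cons, hV]; simp [pb_self]⟩
      · cases t with
        | nil => simp at hl; exact absurd hl hx
        | cons y t =>
          have hy : y = a := by
            have := hs x y ⟨[a], t, by simp⟩
            tauto
          subst hy
          obtain ⟨V, hV⟩ := ih t (by simp at ht; omega) (star_infix hs ⟨[y, x], [], by simp⟩)
            (by simpa using hl)
          exact ⟨x :: V, by rw [psi_cons, hV]; simp [pb_ne hx]⟩

theorem exists_psi {a : A} {v : List A} (hs : star a v) (hh : v.head? = some a)
    (hl : v.getLast? = some a) : ∃ V, v = psi a V ++ [a] := by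
  cases v with
  | nil => simp at hh
  | cons x t =>
    simp at hh; subst hh
    exact exists_psi_aux x t.length t le_rfl hs hl

def SN (a : A) (v : List A) : Prop :=
  star a v ∧ (∀ x y z, [a, x] <:+: v → [a, y] <:+: v → [a, z] <:+: v → x = y ∨ x = z ∨ y = z) ∧
  (∀ x y z, [x, a] <:+: v → [y, a] <:+: v → [z, a] <:+: v → x = y ∨ x = z ∨ y = z) ∧ NS v

def BN (v : List A) : Prop :=
  (∀ x y z, x ∈ v → y ∈ v → z ∈ v → x = y ∨ x = z ∨ y = z) ∧
  ∀ u x y s t, x ≠ y → s ≠ t → x :: (u ++ [s]) <:+: v → x :: (u ++ [t]) <:+: v →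
    y :: (u ++ [s]) <:+: v → y :: (u ++ [t]) <:+: v → False

theorem NS_infix {v c : List A} (h : NS v) (hc : c <:+: v) : NS c :=
  fun u x y s t hu hxy hst h1 h2 h3 h4 => h u x y s t hu hxy hst (h1.trans hc) (h2.trans hc)
    (h3.trans hc) (h4.trans hc)

theorem NS_reverse {v : List A} (h : NS v) : NS v.reverse := by
  intro u x y s t hu hxy hst h1 h2 h3 h4
  rw [← reverse_infix] at h1 h2 h3 h4
  simp only [reverse_cons, reverse_append, reverse_nil, nil_append, singleton_append,
    reverse_reverse, cons_append] at h1 h2 h3 h4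
  exact h u.reverse s t x y (by simpa using hu) hst hxy h1 h3 h2 h4

theorem SN_infix {a : A} {v c : List A} (h : SN a v) (hc : c <:+: v) : SN a c :=
  ⟨star_infix h.1 hc, fun x y z hx hy hz => h.2.1 x y z (hx.trans hc) (hy.trans hc) (hz.trans hc),
    fun x y z hx hy hz => h.2.2.1 x y z (hx.trans hc) (hy.trans hc) (hz.trans hc),
    NS_infix h.2.2.2 hc⟩

theorem pair_reverse {x y : A} {v : List A} : [x, y] <:+: v.reverse ↔ [y, x] <:+: v := by
  rw [← reverse_infix]; simp

theorem SN_reverse {a : A} {v : List A} (h : SN a v) : SN a v.reverse := by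
  refine ⟨star_reverse h.1, ?_, ?_, NS_reverse h.2.2.2⟩
  · intro x y z hx hy hz
    rw [pair_reverse] at hx hy hz
    exact h.2.2.1 x y z hx hy hz
  · intro x y z hx hy hz
    rw [pair_reverse] at hx hy hz
    exact h.2.1 x y z hx hy hz

theorem BN_reverse {v : List A} (h : BN v) : BN v.reverse := by
  refine ⟨by simpa using h.1, ?_⟩
  intro u x y s t hxy hst h1 h2 h3 h4
  rw [← reverse_infix] at h1 h2 h3 h4
  simp only [reverse_cons, reverse_append, reverse_nil, nil_append, singleton_append,
    reverse_reverse, cons_append] at h1 h2 h3 h4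
  exact h.2 u.reverse s t x y hst hxy h1 h3 h2 h4

theorem SN_cons {a b : A} {v : List A} (h : SN a v) (hb : v.head? = some b) (hba : b ≠ a)
    (hab : [a, b] <:+: v) : SN a (a :: v) := by
  obtain ⟨t, rfl⟩ : ∃ t, v = b :: t := by
    cases v with
    | nil => simp at hb
    | cons x t => simp at hb; exact ⟨t, by rw [hb]⟩
  have hst : star a (a :: b :: t) := by
    intro x y hxy
    rw [infix_cons_iff] at hxy
    rcases hxy with hxy | hxy
    · left; simp at hxy; exact hxy.1
    · exact h.1 x y hxy
  have h1 : ∀ x, [a, x] <:+: a :: b :: t → [a, x] <:+: b :: t := by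
    intro x hx
    rw [infix_cons_iff] at hx
    rcases hx with hx | hx
    · simp at hx; rw [hx]; exact hab
    · exact hx
  have h2 : ∀ x, [x, a] <:+: a :: b :: t → [x, a] <:+: b :: t := by
    intro x hx
    rw [infix_cons_iff] at hx
    rcases hx with hx | hx
    · simp at hx; exact absurd hx.2.symm hba
    · exact hx
  refine ⟨hst, fun x y z hx hy hz => h.2.1 x y z (h1 _ hx) (h1 _ hy) (h1 _ hz),
    fun x y z hx hy hz => h.2.2.1 x y z (h2 _ hx) (h2 _ hy) (h2 _ hz), ?_⟩
  intro u x y s t' hu hxy hst' g1 g2 g3 g4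
  obtain ⟨k, u', rfl⟩ := exists_cons_of_ne_nil hu
  have hk : ∀ z r, z :: (k :: u' ++ [r]) <:+: a :: b :: t →
      k = b ∨ z :: (k :: u' ++ [r]) <:+: b :: t := by
    intro z r hz
    rw [infix_cons_iff] at hz
    rcases hz with hz | hz
    · left; simp at hz; exact hz.2.1
    · exact Or.inr hz
  have hkb : k ≠ b := by
    rintro rfl
    have e1 := hst x k (left_infix (u := [x, k]) (t := u' ++ [s]) (by simpa using g1))
    have e2 := hst y k (left_infix (u := [y, k]) (t := u' ++ [s]) (by simpa using g3))
    apply hxy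
    rw [e1.resolve_right hba, e2.resolve_right hba]
  exact h.2.2.2 (k :: u') x y s t' hu hxy hst' ((hk _ _ g1).resolve_left hkb)
    ((hk _ _ g2).resolve_left hkb) ((hk _ _ g3).resolve_left hkb) ((hk _ _ g4).resolve_left hkb)

theorem SN_concat {a b : A} {v : List A} (h : SN a v) (hb : v.getLast? = some b) (hba : b ≠ a)
    (hab : [b, a] <:+: v) : SN a (v ++ [a]) := by
  have := SN_reverse (SN_cons (SN_reverse h) (b := b) (by simpa using hb) hba
    (pair_reverse.2 hab))
  simpa using this

theorem psi_mem_infix {a x : A} {V : List A} (h : x ∈ V) : [a, x] <:+: psi a V ++ [a] := by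
  obtain ⟨s, t, rfl⟩ := append_of_mem h
  obtain ⟨r, hr⟩ := psi_head a t
  rw [psi_append, psi_cons, append_assoc, append_assoc, hr]
  by_cases hx : x = a
  · subst hx; exact ⟨psi x s, r, by simp [pb_self]⟩
  · exact ⟨psi a s, a :: r, by simp [pb_ne hx]⟩

theorem psi_bisp {a x s : A} {u V : List A} (h : x :: (u ++ [s]) <:+: V) :
    x :: ((psi a u ++ [a]) ++ [s]) <:+: psi a V ++ [a] := by
  obtain ⟨l, r, rfl⟩ := h
  obtain ⟨t, ht⟩ := psi_head a r
  have h1 : psi a (l ++ x :: (u ++ [s]) ++ r) ++ [a] =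
      psi a l ++ (pb a x ++ psi a u ++ (pb a s ++ a :: t)) := by
    simp only [psi_append, psi_cons, psi_nil, append_assoc, ht, append_nil]
  rw [h1]
  have h2 : ∃ l', pb a x = l' ++ [x] := by
    by_cases hx : x = a
    · exact ⟨[], by simp [pb, hx]⟩
    · exact ⟨[a], by simp [pb, hx]⟩
  have h3 : ∃ r', pb a s ++ a :: t = [a, s] ++ r' := by
    by_cases hx : s = a
    · exact ⟨t, by simp [pb, hx]⟩
    · exact ⟨a :: t, by simp [pb, hx]⟩
  obtain ⟨l', hl'⟩ := h2
  obtain ⟨r', hr'⟩ := h3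
  rw [hl', hr']
  exact ⟨psi a l ++ l', r', by simp⟩

theorem BN_of_SN {a : A} {V : List A} (h : SN a (psi a V ++ [a])) : BN V := by
  refine ⟨fun x y z hx hy hz => h.2.1 x y z (psi_mem_infix hx) (psi_mem_infix hy)
    (psi_mem_infix hz), ?_⟩
  intro u x y s t hxy hst h1 h2 h3 h4
  exact h.2.2.2 (psi a u ++ [a]) x y s t (by simp) hxy hst (psi_bisp h1) (psi_bisp h2)
    (psi_bisp h3) (psi_bisp h4)

theorem BN_pair {v : List A} (h : BN v) {a b : A} (hab : a ≠ b) (h1 : [a, b] <:+: v)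
    (h2 : [b, a] <:+: v) : SN a v ∨ SN b v := by
  have ha : a ∈ v := h1.subset (by simp)
  have hb : b ∈ v := h1.subset (by simp)
  have hlet : ∀ x ∈ v, x = a ∨ x = b := by
    intro x hx
    rcases h.1 x a b hx ha hb with e | e | e
    · exact Or.inl e
    · exact Or.inr e
    · exact absurd e hab
  have hgen : ∀ c, star c v → SN c v := by
    intro c hc
    have hm : ∀ x y, [x, y] <:+: v → x ∈ v ∧ y ∈ v := fun x y hxy =>
      ⟨hxy.subset (by simp), hxy.subset (by simp)⟩
    exact ⟨hc, fun x y z hx hy hz => h.1 x y z (hm _ _ hx).2 (hm _ _ hy).2 (hm _ _ hz).2,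
      fun x y z hx hy hz => h.1 x y z (hm _ _ hx).1 (hm _ _ hy).1 (hm _ _ hz).1,
      fun u x y s t _ => h.2 u x y s t⟩
  by_cases hbb : [b, b] <:+: v
  · right
    apply hgen
    intro x y hxy
    by_contra hcon
    push Not at hcon
    have e1 := (hlet x (hxy.subset (by simp))).resolve_right hcon.1
    have e2 := (hlet y (hxy.subset (by simp))).resolve_right hcon.2
    rw [e1, e2] at hxy
    exact h.2 [] a b a b hab hab hxy h1 h2 hbb
  · left
    apply hgen
    intro x y hxy
    by_contra hcon
    push Not at hcon
    have e1 := (hlet x (hxy.subset (by simp))).resolve_left hcon.1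
    have e2 := (hlet y (hxy.subset (by simp))).resolve_left hcon.2
    rw [e1, e2] at hxy
    exact hbb hxy

/-- a word starting with `a` and containing another letter has an exit from `a` -/
theorem exists_exit {P : A → Prop} {a b : A} {v : List A} (ha : v.head? = some a) (hPa : P a)
    (hb : b ∈ v) (hPb : ¬ P b) : ∃ x y, P x ∧ ¬ P y ∧ [x, y] <:+: v := by
  induction v generalizing a with
  | nil => simp at ha
  | cons x t ih =>
    simp at ha; subst ha
    cases t with
    | nil => simp at hb; subst hb; exact absurd hPa hPb
    | cons y t =>
      by_cases hy : P y
      · have hb' : b ∈ y :: t := by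
          rcases mem_cons.1 hb with e | e
          · subst e; exact absurd hPa hPb
          · exact e
        obtain ⟨x', y', h1, h2, h3⟩ := ih (a := y) rfl hy hb'
        exact ⟨x', y', h1, h2, h3.trans (suffix_cons _ _).isInfix⟩
      · exact ⟨x, y, hPa, hy, ⟨[], t, by simp⟩⟩

theorem exists_entry {P : A → Prop} {a b : A} {v : List A} (ha : v.getLast? = some a) (hPa : P a)
    (hb : b ∈ v) (hPb : ¬ P b) : ∃ x y, P x ∧ ¬ P y ∧ [y, x] <:+: v := by
  obtain ⟨x, y, h1, h2, h3⟩ := exists_exit (v := v.reverse) (by simpa using ha) hPa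
    (by simpa using hb) hPb
  exact ⟨x, y, h1, h2, pair_reverse.1 h3⟩

theorem SN_of_BN {v : List A} {a : A} (h : BN v) (hh : v.head? = some a)
    (hl : v.getLast? = some a) : ∃ c, SN c v := by
  have ha : a ∈ v := List.mem_of_mem_head? (by simp [hh])
  by_cases hall : ∀ x ∈ v, x = a
  · refine ⟨a, fun x y hxy => Or.inl (hall _ (hxy.subset (by simp))), ?_, ?_, ?_⟩
    · intro x y z hx hy hz
      left; rw [hall x (hx.subset (by simp)), hall y (hy.subset (by simp))]
    · intro x y z hx hy hz
      left; rw [hall x (hx.subset (by simp)), hall y (hy.subset (by simp))]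
    · exact fun u x y s t _ => h.2 u x y s t
  · push Not at hall
    obtain ⟨b, hb, hba⟩ := hall
    obtain ⟨x, y, rfl, hy, hxy⟩ := exists_exit (P := fun z => z = a) hh rfl hb hba
    obtain ⟨x, z, rfl, hz, hxz⟩ := exists_entry (P := fun z => z = x) hl rfl hb hba
    have : y = z := by
      rcases h.1 x y z ha (hxy.subset (by simp)) (hxz.subset (by simp)) with e | e | e
      · exact absurd e.symm hy
      · exact absurd e.symm hz
      · exact e
    subst this
    rcases BN_pair h (Ne.symm hy) hxy hxz with e | e
    · exact ⟨_, e⟩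
    · exact ⟨_, e⟩

theorem pal_getLast {q : List A} (h : q.reverse = q) : q.getLast? = q.head? := by
  conv_rhs => rw [← h]
  simp

theorem prefix_head {p v : List A} (h : p <+: v) (hp : p ≠ []) : v.head? = p.head? := by
  obtain ⟨r, rfl⟩ := h
  cases p with
  | nil => simp at hp
  | cons x p => simp

theorem suffix_last {p v : List A} (h : p <:+ v) (hp : p ≠ []) : v.getLast? = p.getLast? := by
  have := prefix_head (reverse_prefix.2 h) (by simpa using hp)
  simpa using this

theorem CR_step {a : A} {c q : List A} (h : SN a c) (hcr : CR c q) (hq : q ≠ [])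
    (hpal : q.reverse = q) (hh : q.head? = some a) :
    ∃ V Q, c = psi a V ++ [a] ∧ BN V ∧ CR V Q ∧ Q.reverse = Q := by
  obtain ⟨h1, h2, h3, h4⟩ := hcr
  have hql : q.getLast? = some a := by rw [pal_getLast hpal, hh]
  obtain ⟨V, hV⟩ := exists_psi h.1 (by rw [prefix_head h1 hq, hh]) (by rw [suffix_last h2 hq, hql])
  obtain ⟨Q, hQ⟩ := exists_psi (star_infix h.1 h1.isInfix) hh hql
  subst hV; subst hQ
  refine ⟨V, Q, rfl, BN_of_SN h, ⟨psi_prefix h1, psi_suffix h2, ?_, ?_⟩, psi_pal.1 hpal⟩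
  · have h5 := psi_prefix h1
    by_contra hlt
    have := h5.eq_of_length_le (by omega)
    rw [this] at h3; omega
  · intro s t hst
    obtain ⟨r, hr⟩ := psi_head a t
    have := h4 (psi a s) r (by rw [hst]; simp [psi_append, append_assoc, hr])
    rcases this with e | e
    · left
      have := psi_length_ge a s
      rw [e] at this
      simpa using this
    · right
      have := psi_length_ge a t
      have h6 := congrArg List.length hr
      simp [e] at h6
      rw [h6] at this
      simpa using this

theorem CR_ext_prefix {a b : A} {c q : List A} (h : star a c) (h1 : q <+: c)
    (h3 : q.length < c.length) (hl : q.getLast? = some b) (hb : b ≠ a) :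
    a :: q ++ [a] <+: a :: c ++ [a] := by
  obtain ⟨r, rfl⟩ := h1
  cases r with
  | nil => simp at h3
  | cons y r =>
    obtain ⟨q', hq'⟩ : ∃ q', q = q' ++ [b] := by
      have := List.getLast?_eq_some_iff.1 hl
      exact this
    have := h b y ⟨q', r, by simp [hq']⟩
    have hy := this.resolve_left hb
    subst hy
    exact ⟨r ++ [y], by simp⟩

theorem CR_ext {a b : A} {c q : List A} (h : star a c) (hcr : CR c q) (hq : q ≠ [])
    (hpal : q.reverse = q) (hh : q.head? = some b) (hb : b ≠ a) :
    CR (a :: c ++ [a]) (a :: q ++ [a]) := by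
  obtain ⟨h1, h2, h3, h4⟩ := hcr
  have hql : q.getLast? = some b := by rw [pal_getLast hpal, hh]
  refine ⟨CR_ext_prefix h h1 h3 hql hb, ?_, by simpa using h3, ?_⟩
  · have := CR_ext_prefix (star_reverse h) (q := q.reverse) (reverse_prefix.2 h2)
      (by simpa using h3) (b := b) (by rw [hpal]; exact hql) hb
    rw [← reverse_prefix]
    simpa using this
  · intro s t hst
    by_contra hcon
    push Not at hcon
    obtain ⟨x, s', rfl⟩ := exists_cons_of_ne_nil hcon.1
    obtain ⟨t', y, rfl⟩ := eq_nil_or_concat t |>.resolve_left hcon.2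
    have e1 : c ++ [a] = (s' ++ (a :: q ++ [a]) ++ t') ++ [y] := by
      simp at hst ⊢; exact hst.2
    have e2 := (append_inj' e1 rfl).1
    have := h4 (s' ++ [a]) (a :: t') (by rw [e2]; simp)
    simp at this

theorem CRL (n : ℕ) : ∀ (c q : List A) (a : A), c.length ≤ n → SN a c → CR c q → q ≠ [] →
    q.reverse = q → c.reverse = c := by
  induction n with
  | zero =>
    intro c q a hn _ _ _ _
    have : c = [] := by simpa using hn
    subst this; rfl
  | succ n ih =>
    intro c q a hn hS hcr hq hpal
    have fin : ∀ V Q : List A, V.length ≤ n → BN V → CR V Q → Q.reverse = Q → V.reverse = V := by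
      intro V Q hVn hB hc hQ
      by_cases hQ0 : Q = []
      · subst hQ0
        obtain ⟨_, _, _, h4⟩ := hc
        cases V with
        | nil => rfl
        | cons x V =>
          have := h4 [x] V (by simp)
          simp at this
          subst this; rfl
      · obtain ⟨k, Q', rfl⟩ := exists_cons_of_ne_nil hQ0
        obtain ⟨a', ha'⟩ := SN_of_BN hB (a := k) (by rw [prefix_head hc.1 hQ0]; rfl)
          (by rw [suffix_last hc.2.1 hQ0, pal_getLast hQ]; rfl)
        exact ih V _ a' hVn ha' hc hQ0 hQ
    obtain ⟨b, q', hbq⟩ := exists_cons_of_ne_nil hq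
    have hqh : q.head? = some b := by rw [hbq]; rfl
    by_cases hb : b = a
    · rw [hb] at hqh
      obtain ⟨V, Q, rfl, h2, h3, h4⟩ := CR_step hS hcr hq hpal hqh
      apply psi_pal.2
      apply fin V Q _ h2 h3 h4
      have := psi_length_ge a V
      simp at hn; omega
    · have hql : q.getLast? = some b := by rw [pal_getLast hpal, hqh]
      have hch : c.head? = some b := by rw [prefix_head hcr.1 hq, hqh]
      have hcl : c.getLast? = some b := by rw [suffix_last hcr.2.1 hq, hql]
      have hc2 : 2 ≤ c.length := by
        have := length_pos_iff.2 hq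
        have := hcr.2.2.1
        omega
      obtain ⟨c1, hc1⟩ : ∃ c1, c = b :: c1 := by
        cases c with
        | nil => simp at hch
        | cons x t => simp at hch; exact ⟨t, by rw [hch]⟩
      have hc1n : c1 ≠ [] := by
        rintro rfl; simp [hc1] at hc2
      obtain ⟨c2, y, hc2'⟩ := eq_nil_or_concat c1 |>.resolve_left hc1n
      have hyb : y = b := by
        rw [hc1, hc2'] at hcl; simpa [List.getLast?_cons] using hcl
      subst hyb
      have h1 : [y, a] <:+: c := by
        cases c2 with
        | nil =>
          exfalso
          have := hS.1 y y ⟨[], [], by simp [hc1, hc2']⟩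
          tauto
        | cons z c2 =>
          have := hS.1 y z ⟨[], c2 ++ [y], by simp [hc1, hc2']⟩
          have := this.resolve_left hb
          subst this
          exact ⟨[], c2 ++ [y], by simp [hc1, hc2']⟩
      have h2 : [a, y] <:+: c := by
        rcases eq_nil_or_concat c2 with e | ⟨c3, z, e⟩
        · exfalso
          have := hS.1 y y ⟨[], [], by simp [hc1, hc2', e]⟩
          tauto
        · have := hS.1 z y ⟨y :: c3, [], by simp [hc1, hc2', e]⟩
          have := this.resolve_right hb
          subst this
          exact ⟨y :: c3, [], by simp [hc1, hc2', e]⟩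
      have hS1 := SN_cons hS hch hb h2
      have hS2 : SN a (a :: c ++ [a]) := SN_concat hS1 (b := y)
        (by rw [hc1, hc2']; simp [List.getLast?_cons]) hb (h1.trans (suffix_cons _ _).isInfix)
      obtain ⟨V, Q, hV, k2, k3, k4⟩ := CR_step hS2 (CR_ext hS.1 hcr hq hpal hqh hb) (by simp)
        (by simp [hpal]) (by simp)
      have hVn : V.length ≤ n := by
        have e1 := congrArg (List.count a) hV
        rw [count_append, count_append, psi_count] at e1
        rw [hc1, hc2'] at e1
        simp [hb] at e1
        have e2 := count_le_length (a := a) (l := c2)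
        rw [hc1, hc2'] at hn
        simp at hn; omega
      have := (psi_pal (a := a)).2 (fin V Q hVn k2 k3 k4)
      rw [← hV] at this
      simpa using this

theorem rich_of_SN {a : A} {v : List A} (h : SN a v) : Rich v :=
  rich_of_cr fun c q hc hcr hq hpal => CRL c.length c q a le_rfl (SN_infix h hc) hcr hq hpal


/-! ### Separation of the longest palindromic prefix and suffix -/

def Sep (k : ℕ) (v : List A) : Prop := ∃ P Q : List A, P ≠ [] ∧ Q ≠ [] ∧ P <+: v ∧ Q <:+ v ∧
  P.reverse = P ∧ Q.reverse = Q ∧ v.length + k ≤ P.length + Q.length + 1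

theorem Sep_reverse {k : ℕ} {v : List A} (h : Sep k v) : Sep k v.reverse := by
  obtain ⟨P, Q, h1, h2, h3, h4, h5, h6, h7⟩ := h
  refine ⟨Q, P, h2, h1, ?_, ?_, h6, h5, ?_⟩
  · rw [← h6]; exact reverse_prefix.2 h4
  · rw [← h5]; exact reverse_suffix.2 h3
  · simp; omega

theorem Sep_mono {k l : ℕ} {v : List A} (h : Sep k v) (hl : l ≤ k) : Sep l v := by
  obtain ⟨P, Q, h1, h2, h3, h4, h5, h6, h7⟩ := h
  exact ⟨P, Q, h1, h2, h3, h4, h5, h6, by omega⟩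

theorem overlap {P Q V : List A} (h1 : P <+: V) (h2 : Q <:+ V)
    (h : V.length ≤ P.length + Q.length) : ∃ o r, V = P ++ r ∧ Q = o ++ r := by
  obtain ⟨r, rfl⟩ := h1
  have : r <:+ Q := suffix_of_suffix_length_le (suffix_append _ _) h2 (by simp at h; omega)
  obtain ⟨o, rfl⟩ := this
  exact ⟨o, r, rfl, rfl⟩

theorem overlap_psi {a : A} {P Q V : List A} (h1 : P <+: V) (h2 : Q <:+ V)
    (h : V.length ≤ P.length + Q.length) :
    (psi a V).length ≤ (psi a P).length + (psi a Q).length := by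
  obtain ⟨o, r, rfl, rfl⟩ := overlap h1 h2 h
  simp only [psi_append, length_append]; omega

theorem head_cons {b : A} {v : List A} (h : v.head? = some b) : ∃ t, v = b :: t := by
  cases v with
  | nil => simp at h
  | cons x t => simp at h; exact ⟨t, by rw [h]⟩

theorem sepAA {a : A} {v : List A} (h : SN a v) (hh : v.head? = some a)
    (hl : v.getLast? = some a)
    (ih : ∀ V : List A, V.length < v.length → BN V → V ≠ [] → Sep 1 V) : Sep 2 v := by
  obtain ⟨V, rfl⟩ := exists_psi h.1 hh hl
  by_cases hV : V = []
  · subst hV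
    exact ⟨[a], [a], by simp, by simp, by simp, by simp, by simp, by simp, by simp⟩
  · have hlen := psi_length_ge a V
    obtain ⟨P, Q, h1, h2, h3, h4, h5, h6, h7⟩ := ih V (by simp; omega) (BN_of_SN h) hV
    have := overlap_psi (a := a) h3 h4 (by omega)
    refine ⟨psi a P ++ [a], psi a Q ++ [a], by simp, by simp, psi_prefix_mono h3,
      psi_suffix_mono h4, psi_pal.2 h5, psi_pal.2 h6, ?_⟩
    simp; omega

theorem trim {a : A} {P : List A} (hP : P ≠ []) (hpal : P.reverse = P) :
    ∃ p, psi a P = a :: p ∧ p.reverse = p := by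
  obtain ⟨x, P', rfl⟩ := exists_cons_of_ne_nil hP
  obtain ⟨p, hp⟩ := psi_cons_exists a x P'
  refine ⟨p, hp, ?_⟩
  have := (psi_pal (a := a)).2 hpal
  rw [hp] at this
  simpa using this

theorem trim_ne {a b : A} {P V p v y : List A} (hP : P ≠ []) (hPV : P <+: V)
    (hV : psi a V ++ [a] = a :: v ++ y) (hb : v.head? = some b) (hba : b ≠ a)
    (hp : psi a P = a :: p) : p ≠ [] := by
  rintro rfl
  obtain ⟨r, rfl⟩ := hPV
  obtain ⟨t, ht⟩ := psi_head a r
  obtain ⟨v', rfl⟩ := head_cons hb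
  rw [psi_append, append_assoc, hp, ht] at hV
  simp at hV
  exact hba hV.1.symm

theorem BN_lens {a b : A} {c V : List A} (hV : a :: c ++ [a] = psi a V ++ [a])
    (hb : c.head? = some b) (hl : c.getLast? = some b) (hba : b ≠ a) (h2 : 2 ≤ c.length) :
    V.length < c.length := by
  obtain ⟨c1, hc1⟩ := head_cons hb
  have hc1n : c1 ≠ [] := by
    rintro rfl; simp [hc1] at h2
  obtain ⟨c2, y, hc2'⟩ := eq_nil_or_concat c1 |>.resolve_left hc1n
  have hyb : y = b := by
    rw [hc1, hc2'] at hl; simpa [List.getLast?_cons] using hl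
  subst hyb
  have e1 := congrArg (List.count a) hV
  rw [count_append, count_append, psi_count] at e1
  rw [hc1, hc2'] at e1 ⊢
  simp [hba] at e1
  have e2 := count_le_length (a := a) (l := c2)
  simp; omega

theorem sepBA {a b : A} {v : List A} (h : SN a v) (hh : v.head? = some b) (hb : b ≠ a)
    (hab : [a, b] <:+: v) (hl : v.getLast? = some a)
    (ih : ∀ V : List A, V.length < v.length → BN V → V ≠ [] → Sep 1 V) : Sep 1 v := by
  have hS := SN_cons h hh hb hab
  have hvne : v ≠ [] := by rintro rfl; simp at hl
  obtain ⟨V, hV⟩ := exists_psi hS.1 (by simp)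
    (by rw [← hl]; exact suffix_last (suffix_cons _ _) hvne)
  have hVB : BN V := BN_of_SN (hV ▸ hS)
  have hVne : V ≠ [] := by
    rintro rfl
    simp at hV; exact hvne hV
  have hlen : (psi a V).length = v.length := by
    have := congrArg List.length hV
    simp at this; omega
  have hVlt : V.length < v.length := by
    have e1 := congrArg (List.count a) hV
    rw [count_append, psi_count] at e1
    obtain ⟨t, rfl⟩ := head_cons hh
    simp [hb] at e1
    have e2 := count_le_length (a := a) (l := t)
    simp; omega
  obtain ⟨P, Q, h1, h2, h3, h4, h5, h6, h7⟩ := ih V hVlt hVB hVne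
  have hov := overlap_psi (a := a) h3 h4 (by omega)
  have hpre : ∀ P p, P <+: V → psi a P = a :: p → p <+: v := by
    rintro P p ⟨r, rfl⟩ hp
    rw [psi_append, hp] at hV
    simp at hV
    rw [hV]
    exact ⟨psi a r ++ [a], by simp⟩
  by_cases hQV : Q = V
  · subst hQV
    obtain ⟨p, hp, hpp⟩ := trim (a := a) h2 h6
    refine ⟨p, [a], trim_ne (y := []) h2 (prefix_refl _) (by simpa using hV.symm) hh hb hp, by simp,
      hpre _ _ (prefix_refl _) hp, ?_, hpp, by simp, ?_⟩
    · have : ∃ s, v = s ++ [a] := List.getLast?_eq_some_iff.1 hl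
      obtain ⟨s, rfl⟩ := this
      exact suffix_append _ _
    · rw [hp] at hlen
      simp at hlen ⊢; omega
  · obtain ⟨p, hp, hpp⟩ := trim (a := a) h1 h5
    refine ⟨p, psi a Q ++ [a], trim_ne (y := []) h1 h3 (by simpa using hV.symm) hh hb hp, by simp,
      hpre _ _ h3 hp, ?_, hpp, psi_pal.2 h6, ?_⟩
    · have e1 := psi_suffix_mono (a := a) h4
      rw [← hV, suffix_cons_iff] at e1
      rcases e1 with e1 | e1
      · rw [hV] at e1; exact absurd (psi_inj e1) hQV
      · exact e1
    · rw [hp] at hov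
      simp at hov ⊢; omega

theorem sepBB {a b c : A} {v V : List A} (hh : v.head? = some b) (hb : b ≠ a)
    (hl : v.getLast? = some c) (hc : c ≠ a) (hV : a :: v ++ [a] = psi a V ++ [a])
    (ih : Sep 1 V) : Sep 0 v ∧ (b = c → Sep 2 V → Sep 2 v) := by
  have hVr : psi a V.reverse ++ [a] = a :: v.reverse ++ [a] := by
    rw [← psi_reverse, ← hV]; simp
  have hlen : (psi a V).length = v.length + 1 := by
    have := congrArg List.length hV
    simp at this; omega
  have hpre : ∀ v V : List A, psi a V ++ [a] = a :: v ++ [a] →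
      ∀ P p, P <+: V → psi a P = a :: p → p <+: v := by
    rintro v V hV P p ⟨r, rfl⟩ hp
    rw [psi_append, hp] at hV
    simp at hV
    rw [← append_assoc] at hV
    have := (append_inj' hV rfl).1
    exact ⟨psi a r, this⟩
  have main : ∀ P Q : List A, P ≠ [] → Q ≠ [] → P <+: V → Q <:+ V → P.reverse = P →
      Q.reverse = Q → ∃ p q : List A, p ≠ [] ∧ q ≠ [] ∧ p <+: v ∧ q <:+ v ∧ p.reverse = p ∧
        q.reverse = q ∧ (psi a P).length = p.length + 1 ∧ (psi a Q).length = q.length + 1 := by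
    intro P Q h1 h2 h3 h4 h5 h6
    obtain ⟨p, hp, hpp⟩ := trim (a := a) h1 h5
    obtain ⟨q, hq, hqp⟩ := trim (a := a) h2 h6
    have h4' : Q <+: V.reverse := by rw [← h6]; exact reverse_prefix.2 h4
    refine ⟨p, q, trim_ne h1 h3 hV.symm hh hb hp,
      trim_ne h2 h4' hVr (by simpa using hl) hc hq, hpre _ _ hV.symm _ _ h3 hp, ?_, hpp, hqp,
      by simp [hp], by simp [hq]⟩
    rw [← hqp, ← reverse_prefix, reverse_reverse]
    exact hpre _ _ hVr _ _ h4' hq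
  constructor
  · obtain ⟨P, Q, h1, h2, h3, h4, h5, h6, h7⟩ := ih
    obtain ⟨p, q, g1, g2, g3, g4, g5, g6, g7, g8⟩ := main P Q h1 h2 h3 h4 h5 h6
    have hov := overlap_psi (a := a) h3 h4 (by omega)
    exact ⟨p, q, g1, g2, g3, g4, g5, g6, by omega⟩
  · rintro rfl ⟨P, Q, h1, h2, h3, h4, h5, h6, h7⟩
    obtain ⟨p, q, g1, g2, g3, g4, g5, g6, g7, g8⟩ := main P Q h1 h2 h3 h4 h5 h6
    have hQh : Q.head? = some b := by
      -- the head of `Q` is the head of `V.reverse`, which is `b`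
      obtain ⟨x, Q', rfl⟩ := exists_cons_of_ne_nil h2
      have h4' : x :: Q' <+: V.reverse := by rw [← h6]; exact reverse_prefix.2 h4
      obtain ⟨r, hr⟩ := h4'
      rw [← hr, cons_append, psi_cons] at hVr
      obtain ⟨s, hs⟩ := head_cons (v := v.reverse) (b := b) (by simpa using hl)
      rw [hs] at hVr
      obtain ⟨t, ht⟩ := psi_head a (Q' ++ r)
      by_cases hx : x = a
      · subst hx
        rw [append_assoc, ht] at hVr
        simp [pb_self] at hVr
        exact absurd hVr.1.symm hb
      · simp [pb_ne hx] at hVr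
        simp [hVr.1]
    obtain ⟨o, r, hV', hQ'⟩ := overlap h3 h4 (by omega)
    have ho : o ≠ [] := by
      rintro rfl
      rw [hV', hQ'] at h7; simp at h7
    obtain ⟨y, o', rfl⟩ := exists_cons_of_ne_nil ho
    rw [hQ'] at hQh
    simp at hQh; subst hQh
    have e1 : (psi a Q).length = 2 + (psi a o').length + (psi a r).length := by
      rw [hQ']; simp [psi_cons, psi_append, pb_ne hb]; omega
    have e2 : (psi a V).length = (psi a P).length + (psi a r).length := by
      rw [hV', psi_append, length_append]
    exact ⟨p, q, g1, g2, g3, g4, g5, g6, by omega⟩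

theorem two_blocks {a b : A} {v : List A} (hab : a ≠ b) (hl : ∀ x ∈ v, x = a ∨ x = b)
    (h : ¬ [b, a] <:+: v) : ∃ n m, v = replicate n a ++ replicate m b := by
  induction v with
  | nil => exact ⟨0, 0, rfl⟩
  | cons x t ih =>
    obtain ⟨n, m, hnm⟩ := ih (fun x hx => hl x (mem_cons_of_mem _ hx))
      (fun hh => h (hh.trans (suffix_cons _ _).isInfix))
    rcases hl x mem_cons_self with e | e
    · exact ⟨n + 1, m, by rw [hnm, e]; simp [replicate_succ]⟩
    · subst e
      cases n with
      | zero => exact ⟨0, m + 1, by rw [hnm]; simp [replicate_succ]⟩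
      | succ n =>
        exfalso
        apply h
        rw [hnm, replicate_succ]
        exact ⟨[], replicate n a ++ replicate m x, by simp⟩

theorem star_ends {a b : A} {c : List A} (hs : star a c) (hch : c.head? = some b)
    (hc2 : 2 ≤ c.length) (hb : b ≠ a) : [b, a] <:+: c := by
  obtain ⟨c1, rfl⟩ := head_cons hch
  cases c1 with
  | nil => simp at hc2
  | cons z c2 =>
    have := (hs b z ⟨[], c2, by simp⟩).resolve_left hb
    subst this
    exact ⟨[], c2, by simp⟩

theorem star_ends_last {a b : A} {c : List A} (hs : star a c) (hch : c.getLast? = some b)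
    (hc2 : 2 ≤ c.length) (hb : b ≠ a) : [a, b] <:+: c :=
  pair_reverse.1 (star_ends (star_reverse hs) (by simpa using hch) (by simpa using hc2) hb)

theorem head_last_exists {v : List A} (h : v ≠ []) : ∃ b c, v.head? = some b ∧
    v.getLast? = some c := by
  refine ⟨v.head h, v.getLast h, head?_eq_some_head h, getLast?_eq_some_getLast h⟩

theorem SN_both {a b c : A} {v : List A} (h : SN a v) (hh : v.head? = some b) (hb : b ≠ a)
    (hab : [a, b] <:+: v) (hl : v.getLast? = some c) (hc : c ≠ a) (hca : [c, a] <:+: v) :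
    SN a (a :: v ++ [a]) ∧ ∃ V, a :: v ++ [a] = psi a V ++ [a] ∧ BN V ∧ V ≠ [] := by
  have hvne : v ≠ [] := by rintro rfl; simp at hl
  have hS := SN_cons h hh hb hab
  have hS2 : SN a (a :: v ++ [a]) := SN_concat hS (b := c)
    (by rw [← hl]; exact suffix_last (suffix_cons _ _) hvne) hc
    (hca.trans (suffix_cons _ _).isInfix)
  obtain ⟨V, hV⟩ := exists_psi hS2.1 (by simp)
    (by rw [suffix_last (p := [a]) ⟨a :: v, rfl⟩ (by simp)]; rfl)
  refine ⟨hS2, V, hV, BN_of_SN (hV ▸ hS2), ?_⟩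
  rintro rfl
  simp at hV

theorem sepBN (n : ℕ) : ∀ v : List A, v.length ≤ n → BN v → v ≠ [] →
    Sep 1 v ∧ (v.head? = v.getLast? → Sep 2 v) := by
  induction n with
  | zero =>
    intro v hn _ hne
    exact absurd (by simpa using hn) hne
  | succ n ih =>
    intro v hn hB hne
    have ih1 : ∀ V : List A, V.length < v.length → BN V → V ≠ [] → Sep 1 V :=
      fun V h1 h2 h3 => (ih V (by omega) h2 h3).1
    obtain ⟨b, c, hb, hc⟩ := head_last_exists hne
    by_cases hbc : b = c
    · subst hbc
      suffices Sep 2 v from ⟨Sep_mono this (by omega), fun _ => this⟩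
      obtain ⟨a, ha⟩ := SN_of_BN hB hb hc
      by_cases hba : b = a
      · subst hba
        exact sepAA ha hb hc ih1
      · by_cases h2 : 2 ≤ v.length
        · obtain ⟨_, V, hV, hBV, hVne⟩ := SN_both ha hb hba (star_ends_last ha.1 hc h2 hba) hc hba
            (star_ends ha.1 hb h2 hba)
          have hVlt := BN_lens hV hb hc hba h2
          have hI := ih V (by omega) hBV hVne
          obtain ⟨-, h3⟩ := sepBB hb hba hc hba hV hI.1
          apply h3 rfl
          apply hI.2
          -- head and last of `V` are both `b`
          have hhd : ∀ (V w : List A), a :: w ++ [a] = psi a V ++ [a] → w.head? = some b →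
              V.head? = some b := by
            intro V w hV hw
            obtain ⟨w', rfl⟩ := head_cons hw
            cases V with
            | nil => simp at hV
            | cons x V =>
              obtain ⟨t, ht⟩ := psi_head a V
              rw [psi_cons] at hV
              by_cases hx : x = a
              · subst hx
                rw [append_assoc, ht] at hV
                simp [pb_self] at hV
                exact absurd hV.1 hba
              · simp [pb_ne hx] at hV
                simp [hV.1]
          rw [hhd V v hV hb]
          have := hhd V.reverse v.reverse (by rw [← psi_reverse, ← hV]; simp) (by simpa using hc)
          simpa using this.symm
        · have : v = [b] := by
            obtain ⟨t, rfl⟩ := head_cons hb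
            simp at h2
            have : t = [] := by
              cases t with
              | nil => rfl
              | cons y t => simp at h2
            rw [this]
          subst this
          exact ⟨[b], [b], by simp, by simp, by simp, by simp, by simp, by simp, by simp⟩
    · refine ⟨?_, fun h => absurd (by rw [hb, hc] at h; simpa using h) hbc⟩
      have hbm : b ∈ v := List.mem_of_mem_head? (by simp [hb])
      have hcm : c ∈ v := List.mem_of_mem_getLast? (by simp [hc])
      have hlet : ∀ x ∈ v, x = b ∨ x = c := by
        intro x hx
        rcases hB.1 x b c hx hbm hcm with e | e | e
        · exact Or.inl e
        · exact Or.inr e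
        · exact absurd e hbc
      by_cases hcb : [c, b] <:+: v
      · have hbc' : [b, c] <:+: v := by
          obtain ⟨x, y, rfl, hy, hxy⟩ := exists_exit (P := fun z => z = b) hb rfl hcm (Ne.symm hbc)
          have := (hlet y (hxy.subset (by simp))).resolve_left hy
          rw [← this]; exact hxy
        rcases BN_pair hB hbc hbc' hcb with e | e
        · have := sepBA (SN_reverse e) (b := c) (by simpa using hc) (Ne.symm hbc)
            (pair_reverse.2 hcb) (by simpa using hb) (by simpa using ih1)
          simpa using Sep_reverse this
        · exact sepBA e hb hbc hcb hc ih1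
      · obtain ⟨k, m, hkm⟩ := two_blocks hbc hlet hcb
        refine ⟨replicate k b, replicate m c, ?_, ?_, ?_, ?_, by simp, by simp, by rw [hkm]; simp⟩
        · intro h
          rw [hkm, h] at hbm
          simp at hbm; exact hbc hbm.2
        · intro h
          rw [hkm, h] at hcm
          simp at hcm; exact hbc hcm.2.symm
        · rw [hkm]; exact prefix_append _ _
        · rw [hkm]; exact suffix_append _ _

/-- Separation for the words coming from hearts. -/
theorem sepSN {a b c : A} {v : List A} (h : SN a v) (hh : v.head? = some b)
    (hl : v.getLast? = some c) (hab : b ≠ a → [a, b] <:+: v) (hca : c ≠ a → [c, a] <:+: v) :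
    Sep 0 v ∧ (b = a ∨ c = a → Sep 1 v) := by
  have hS : ∀ V : List A, BN V → V ≠ [] → Sep 1 V := fun V h1 h2 => (sepBN _ V le_rfl h1 h2).1
  by_cases hb : b = a <;> by_cases hc : c = a
  · subst hb; subst hc
    have := sepAA h hh hl (fun V _ => hS V)
    exact ⟨Sep_mono this (by omega), fun _ => Sep_mono this (by omega)⟩
  · subst hb
    have := sepBA (SN_reverse h) (b := c) (by simpa using hl) hc
            (pair_reverse.2 (hca hc)) (by simpa using hh) (fun V _ => hS V)
    have := Sep_reverse this
    rw [reverse_reverse] at this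
    exact ⟨Sep_mono this (by omega), fun _ => this⟩
  · subst hc
    have := sepBA h hh hb (hab hb) hl (fun V _ => hS V)
    exact ⟨Sep_mono this (by omega), fun _ => this⟩
  · obtain ⟨_, V, hV, hBV, hVne⟩ := SN_both h hh hb (hab hb) hl hc (hca hc)
    exact ⟨(sepBB hh hb hl hc hV (hS V hBV hVne)).1, fun h => by tauto⟩


/-! ### Structure of hearts -/

def Sym (v : List A) : Prop := ∀ x y, [x, y] <:+: v → [y, x] <:+: v

def HR (v : List A) : Prop := ∃ b t, v = b :: t ∧ b ∈ t

theorem Sym_pal {p : List A} (h : p.reverse = p) : Sym p := by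
  intro x y hxy
  rw [← h, pair_reverse]; exact hxy

theorem Sym_reverse {p : List A} (h : Sym p) : Sym p.reverse := by
  intro x y hxy
  rw [pair_reverse] at hxy ⊢
  exact h _ _ hxy

theorem RD_infix {v c : List A} (h : RD v) (hc : c <:+: v) : RD c :=
  ⟨fun x y a b c' d h1 h2 h3 h4 => h.1 x y a b c' d (h1.trans hc) (h2.trans hc) (h3.trans hc)
    (h4.trans hc), fun x a b c' h1 h2 h3 => h.2 x a b c' (h1.trans hc) (h2.trans hc) (h3.trans hc)⟩

theorem pair_append {x y : A} {s t : List A} (h : [x, y] <:+: s ++ t) :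
    [x, y] <:+: s ∨ [x, y] <:+: t ∨ (∃ s', s = s' ++ [x]) ∧ ∃ t', t = y :: t' := by
  induction s with
  | nil => exact Or.inr (Or.inl (by simpa using h))
  | cons z s ih =>
    rw [cons_append, infix_cons_iff] at h
    rcases h with h | h
    · cases s with
      | nil =>
        cases t with
        | nil => simp at h
        | cons k t =>
          simp at h
          exact Or.inr (Or.inr ⟨⟨[], by simp [h.1]⟩, t, by simp [h.2]⟩)
      | cons k s =>
        simp at h
        left; exact ⟨[], s, by simp [h.1, h.2]⟩
    · rcases ih h with h | h | ⟨⟨s', rfl⟩, t', rfl⟩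
      · exact Or.inl (h.trans (suffix_cons _ _).isInfix)
      · exact Or.inr (Or.inl h)
      · exact Or.inr (Or.inr ⟨⟨z :: s', rfl⟩, t', rfl⟩)

theorem closed_all {S : A → Prop} {v : List A} (h : ∀ x y, [x, y] <:+: v → (S x ↔ S y))
    {a b : A} (ha : a ∈ v) (hb : b ∈ v) (hS : S a) : S b := by
  have key : ∀ v : List A, (∀ x y, [x, y] <:+: v → (S x ↔ S y)) →
      ∀ z t, v = z :: t → ∀ k ∈ v, (S k ↔ S z) := by
    intro v
    induction v with
    | nil => intro _ z t h; simp at h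
    | cons z t ih =>
      intro h z' t' he k hk
      simp at he
      obtain ⟨rfl, rfl⟩ := he
      rcases mem_cons.1 hk with e | e
      · rw [e]
      · cases t with
        | nil => simp at e
        | cons y t =>
          rw [ih (fun x y hxy => h x y (hxy.trans (suffix_cons _ _).isInfix)) y t rfl k e]
          exact (h z y ⟨[], t, by simp⟩).symm
  obtain ⟨z, t, rfl⟩ := exists_cons_of_ne_nil (List.ne_nil_of_mem ha)
  rw [key _ h z t rfl b hb, ← key _ h z t rfl a ha]
  exact hS

theorem star_of_Sym {v : List A} {a : A} (ha : a ∈ v)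
    (h : ∀ x s t, [x, s] <:+: v → [x, t] <:+: v → s ≠ t → x = a) (hs : Sym v) : star a v := by
  intro x y hxy
  by_contra hcon
  push Not at hcon
  have hyx := hs _ _ hxy
  have hux : ∀ s, [x, s] <:+: v → s = y := by
    intro s hs'
    by_contra hne
    exact hcon.1 (h x s y hs' hxy hne)
  have huy : ∀ s, [y, s] <:+: v → s = x := by
    intro s hs'
    by_contra hne
    exact hcon.2 (h y s x hs' hyx hne)
  have hS := closed_all (S := fun z => z = x ∨ z = y) (v := v) (a := x) (b := a) (by
    have one : ∀ p q, [p, q] <:+: v → (p = x ∨ p = y) → (q = x ∨ q = y) := by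
      rintro p q hpq (rfl | rfl)
      · exact Or.inr (hux _ hpq)
      · exact Or.inl (huy _ hpq)
    exact fun p q hpq => ⟨one p q hpq, one q p (hs _ _ hpq)⟩)
    (hxy.subset (by simp)) ha (Or.inl rfl)
  rcases hS with e | e
  · exact hcon.1 e.symm
  · exact hcon.2 e.symm

theorem SN_of_Sym {v : List A} (hR : RD v) (hN : NS v) (hs : Sym v) (hne : v ≠ []) :
    ∃ a ∈ v, SN a v := by
  have : ∃ a ∈ v, ∀ x s t, [x, s] <:+: v → [x, t] <:+: v → s ≠ t → x = a := by
    by_cases hex : ∃ a s t, [a, s] <:+: v ∧ [a, t] <:+: v ∧ s ≠ t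
    · obtain ⟨a, s, t, h1, h2, h3⟩ := hex
      exact ⟨a, h1.subset (by simp), fun x s' t' g1 g2 g3 => hR.1 x a s' t' s t g1 g2 h1 h2 g3 h3⟩
    · obtain ⟨a, t, rfl⟩ := exists_cons_of_ne_nil hne
      exact ⟨a, by simp, fun x s t h1 h2 h3 => absurd ⟨x, s, t, h1, h2, h3⟩ hex⟩
  obtain ⟨a, ha, h⟩ := this
  exact ⟨a, ha, star_of_Sym ha h hs, fun x y z => hR.2 a x y z,
    fun x y z h1 h2 h3 => hR.2 a x y z (hs _ _ h1) (hs _ _ h2) (hs _ _ h3), hN⟩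

theorem rich_of_Sym {v : List A} (hR : RD v) (hN : NS v) (hs : Sym v) : Rich v := by
  by_cases hne : v = []
  · subst hne; exact rich_nil
  · obtain ⟨a, _, h⟩ := SN_of_Sym hR hN hs hne
    exact rich_of_SN h

theorem conn {S : A → Prop} {p q : List A} {k y z : A} (hp : ∀ x y, [x, y] <:+: p → (S x ↔ S y))
    (hq : ∀ x y, [x, y] <:+: q → (S x ↔ S y)) (hkp : k ∈ p) (hkq : k ∈ q) (hy : y ∈ p ∨ y ∈ q)
    (hz : z ∈ p ∨ z ∈ q) (hS : S y) : S z := by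
  have hk : S k := by
    rcases hy with h | h
    · exact closed_all hp h hkp hS
    · exact closed_all hq h hkq hS
  rcases hz with h | h
  · exact closed_all hp hkp h hk
  · exact closed_all hq hkq h hk

theorem junction {v p q : List A} {k y z : A} (hR : RD v) (hpv : p <:+: v) (hqv : q <:+: v)
    (hp : Sym p) (hq : Sym q) (hkp : k ∈ p) (hkq : k ∈ q) (hy : y ∈ p ∨ y ∈ q)
    (hz : z ∈ p ∨ z ∈ q) (hyz : [y, z] <:+: v) : [z, y] <:+: v := by
  by_contra hcon
  have hne : y ≠ z := by rintro rfl; exact hcon hyz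
  let E : A → A → Prop := fun x t => [x, t] <:+: p ∨ [x, t] <:+: q
  have hEs : ∀ x t, E x t → E t x := by
    rintro x t (h | h)
    · exact Or.inl (hp _ _ h)
    · exact Or.inr (hq _ _ h)
  have hEv : ∀ x t, E x t → [x, t] <:+: v := by
    rintro x t (h | h)
    · exact h.trans hpv
    · exact h.trans hqv
  have cn : ∀ S : A → Prop, (∀ x t, E x t → S x → S t) → S y → S z := by
    intro S hS hSy
    exact conn (fun x t h => ⟨hS x t (Or.inl h), hS t x (hEs _ _ (Or.inl h))⟩)
      (fun x t h => ⟨hS x t (Or.inr h), hS t x (hEs _ _ (Or.inr h))⟩) hkp hkq hy hz hSy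
  have hex : ∃ y2, E y y2 := by
    by_contra hno
    push Not at hno
    have := cn (fun x => x = y) (by rintro x t h rfl; exact absurd h (hno t)) rfl
    exact hne this.symm
  obtain ⟨y2, hy2⟩ := hex
  have hz2 : ∀ s, E y s → s ≠ z := by
    rintro s h rfl
    exact hcon (hEv _ _ (hEs _ _ h))
  have hu : ∀ s, E y s → s = y2 := by
    intro s h
    rcases hR.2 y z y2 s hyz (hEv _ _ hy2) (hEv _ _ h) with e | e | e
    · exact absurd e.symm (hz2 _ hy2)
    · exact absurd e.symm (hz2 _ h)
    · exact e.symm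
  have hu2 : ∀ s, E y2 s → y2 ≠ y → s = y := by
    intro s h hyy
    by_contra hs
    exact hyy (hR.1 y2 y s y y2 z (hEv _ _ h) (hEv _ _ (hEs _ _ hy2)) (hEv _ _ hy2) hyz hs
      (hz2 _ hy2))
  have := cn (fun x => x = y ∨ x = y2) (by
    rintro x t h (rfl | rfl)
    · exact Or.inr (hu _ h)
    · by_cases hyy : x = y
      · subst hyy; exact Or.inr (hu _ h)
      · exact Or.inl (hu2 _ h hyy)) (Or.inl rfl)
  rcases this with e | e
  · exact hne e.symm
  · exact hz2 _ hy2 e.symm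

theorem Sym_of_touch {v p q : List A} {k : A} (hR : RD v) (hp : p <+: v) (hq : q <:+ v)
    (hpp : p.reverse = p) (hqp : q.reverse = q) (hlen : v.length ≤ p.length + q.length)
    (hkp : k ∈ p) (hkq : k ∈ q) : Sym v := by
  intro x y hxy
  obtain ⟨o, r, hv, hqo⟩ := overlap hp hq hlen
  have hrq : r <:+: q := hqo ▸ (suffix_append o r).isInfix
  rw [hv] at hxy
  rcases pair_append hxy with h | h | ⟨⟨s, hs⟩, t, ht⟩
  · exact (Sym_pal hpp _ _ h).trans hp.isInfix
  · exact (Sym_pal hqp _ _ (h.trans hrq)).trans hq.isInfix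
  · rw [← hv] at hxy
    exact junction hR hp.isInfix hq.isInfix (Sym_pal hpp) (Sym_pal hqp) hkp hkq
      (Or.inl (by simp [hs])) (Or.inr (by simp [hqo, ht])) hxy

theorem Sym_of_gap {v p q : List A} {k x : A} (hR : RD v) (hL : RD v.reverse)
    (hv : v = p ++ [x] ++ q)
    (hpp : p.reverse = p) (hqp : q.reverse = q) 
    (hkp : k ∈ p) (hkq : k ∈ q) (hx : x ∈ p ∨ x ∈ q) : Sym v := by
  intro y z hyz
  have hpi : p <:+: v := ⟨[], [x] ++ q, by simp [hv]⟩
  have hqi : q <:+: v := ⟨p ++ [x], [], by simp [hv]⟩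
  have hyz' := hyz
  rw [hv] at hyz'
  have conv : ∀ y z, [y, z] <:+: v → (y ∈ p ∨ y ∈ q) → (z ∈ p ∨ z ∈ q) → [z, y] <:+: v :=
    fun y z h h1 h2 => junction hR hpi hqi (Sym_pal hpp) (Sym_pal hqp) hkp hkq h1 h2 h
  rcases pair_append hyz' with h | h | ⟨⟨s, hs⟩, t, ht⟩
  · rcases pair_append h with h | h | ⟨⟨s, hs⟩, t, ht⟩
    · exact (Sym_pal hpp _ _ h).trans hpi
    · have := h.length_le; simp at this
    · simp at ht
      exact conv _ _ hyz (Or.inl (by simp [hs])) (by rw [← ht.1]; exact hx)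
  · exact (Sym_pal hqp _ _ h).trans hqi
  · have hs' := (append_inj' hs rfl).2
    simp at hs'
    exact conv _ _ hyz (by rw [← hs']; exact hx) (Or.inr (by simp [ht]))

theorem f_det {v p f : List A} {l e : A} (hR : RD v) (hpf : p <:+: f) (hfv : f <:+: v)
    (hp : Sym p) (hf : ∀ x ∈ f, x ∈ p) (hl : l ∈ f) (he : e ∉ f) (hle : [l, e] <:+: v) :
    ∀ x s t, [x, s] <:+: f → [x, t] <:+: f → s = t := by
  intro x s t h1 h2
  by_contra hst
  by_cases hex : ∃ s0, [l, s0] <:+: f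
  · obtain ⟨s0, hs0⟩ := hex
    have hse : ∀ x s, [x, s] <:+: f → e ≠ s := by
      rintro x s h rfl; exact he (h.subset (by simp))
    have hxl := hR.1 x l s t e s0 (h1.trans hfv) (h2.trans hfv) hle (hs0.trans hfv) hst (hse _ _ hs0)
    subst hxl
    rcases hR.2 x e s t hle (h1.trans hfv) (h2.trans hfv) with e' | e' | e'
    · exact hse _ _ h1 e'
    · exact hse _ _ h2 e'
    · exact hst e'
  · push Not at hex
    have hall : ∀ z ∈ f, z = l := by
      intro z hz
      refine closed_all (S := fun z => z = l) (v := p) ?_ (hf _ hl) (hf _ hz) rfl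
      intro x y hxy
      constructor
      · rintro rfl; exact absurd (hxy.trans hpf) (hex _)
      · rintro rfl; exact absurd ((hp _ _ hxy).trans hpf) (hex _)
    exact hst ((hall s (h1.subset (by simp))).trans (hall t (h2.subset (by simp))).symm)

theorem f_Sym {v p f : List A} {l e : A} (hR : RD v) (hpf : p <:+: f) (hfv : f <:+: v)
    (hp : Sym p) (hf : ∀ x ∈ f, x ∈ p) (hl : l ∈ f) (he : e ∉ f) (hle : [l, e] <:+: v) :
    Sym f := by
  have hdet := f_det hR hpf hfv hp hf hl he hle
  intro x y hxy
  by_cases hex : ∃ x', [x, x'] <:+: p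
  · obtain ⟨x', hx'⟩ := hex
    have := hdet x y x' hxy (hx'.trans hpf)
    subst this
    exact (hp _ _ hx').trans hpf
  · push Not at hex
    have hall : ∀ z ∈ f, z = x := by
      intro z hz
      refine closed_all (S := fun z => z = x) (v := p) ?_ (hf _ (hxy.subset (by simp))) (hf _ hz) rfl
      intro x1 y1 hxy1
      constructor
      · rintro rfl; exact absurd hxy1 (hex _)
      · rintro rfl; exact absurd (hp _ _ hxy1) (hex _)
    have := hall y (hxy.subset (by simp))
    subst this; exact hxy

theorem nodup_mid {f Z : List A} (hf : f ≠ []) (hd : ∀ x ∈ f, x ∉ Z)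
    (hu : ∀ z ∈ Z, ∀ x y, [x, z] <:+: f ++ Z → [y, z] <:+: f ++ Z → x = y) : Z.Nodup := by
  induction Z using List.reverseRecOn with
  | nil => exact nodup_nil
  | append_singleton Z' z ih =>
    have hi : f ++ Z' <:+: f ++ (Z' ++ [z]) := ⟨[], [z], by simp⟩
    have hZ' := ih (fun x hx h => hd x hx (by simp [h]))
      (fun z' hz' x y h1 h2 => hu z' (by simp [hz']) x y (h1.trans hi) (h2.trans hi))
    rw [nodup_append]
    refine ⟨hZ', by simp, ?_⟩
    rintro a ha b hb rfl
    simp at hb; subst hb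
    obtain ⟨s, t, rfl⟩ := append_of_mem ha
    obtain ⟨r, m1, h1⟩ := eq_nil_or_concat (f ++ s) |>.resolve_left (by simp [hf])
    obtain ⟨r', m2, h2⟩ := eq_nil_or_concat (a :: t) |>.resolve_left (by simp)
    have e := hu a (by simp) m1 m2 ⟨r, t ++ [a], by
      have : f ++ (s ++ a :: t ++ [a]) = (f ++ s) ++ (a :: t ++ [a]) := by simp
      rw [this, h1]; simp⟩ ⟨f ++ s ++ r', [], by
      have : f ++ (s ++ a :: t ++ [a]) = (f ++ s) ++ (a :: t) ++ [a] := by simp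
      rw [this, h2]; simp⟩
    have hm1 : m1 ∈ f ++ s := by rw [h1]; simp
    have hm2 : m2 ∈ a :: t := by rw [h2]; simp
    rw [← e] at hm2
    rcases mem_append.1 hm1 with h | h
    · exact hd m1 h (by simp at hm2 ⊢; tauto)
    · rw [nodup_append] at hZ'
      exact hZ'.2.2 m1 h m1 hm2 rfl

structure Good (v : List A) : Prop where
  rd : RD v
  ld : RD v.reverse
  ns : NS v
  hr : HR v
  lr : HR v.reverse

theorem Good.rev {v : List A} (h : Good v) : Good v.reverse :=
  ⟨h.ld, by simpa using h.rd, NS_reverse h.ns, h.lr, by simpa using h.hr⟩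

/-- (⇐) for separated alphabets. -/
theorem rich_of_disj {v p q u₁ Z u₂ : List A} (hG : Good v)
    (hv : v = (p ++ u₁) ++ Z ++ (u₂ ++ q)) (hp0 : p ≠ []) (hq0 : q ≠ [])
    (hpp : p.reverse = p) (hqp : q.reverse = q) (hpq : ∀ x ∈ p, x ∉ q)
    (h1 : ∀ x ∈ u₁, x ∈ p) (h2 : ∀ x ∈ u₂, x ∈ q) (hZp : ∀ x ∈ Z, x ∉ p) (hZq : ∀ x ∈ Z, x ∉ q) :
    Rich v := by
  have hfp : ∀ x ∈ p ++ u₁, x ∈ p := by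
    intro x hx
    rcases mem_append.1 hx with h | h
    · exact h
    · exact h1 _ h
  have hgq : ∀ x ∈ u₂ ++ q, x ∈ q := by
    intro x hx
    rcases mem_append.1 hx with h | h
    · exact h2 _ h
    · exact h
  have hpf : p <:+: p ++ u₁ := (prefix_append _ _).isInfix
  have hqg : q <:+: u₂ ++ q := (suffix_append _ _).isInfix
  generalize hf : p ++ u₁ = f at *
  generalize hg : u₂ ++ q = g at *
  have hf0 : f ≠ [] := by rw [← hf]; simp [hp0]
  have hg0 : g ≠ [] := by rw [← hg]; simp [hq0]
  have hfZ : ∀ x ∈ f, x ∉ Z := fun x hx hz => hZp x hz (hfp x hx)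
  have hfg : ∀ x ∈ f, x ∉ g := fun x hx hz => hpq x (hfp x hx) (hgq x hz)
  have hgZ : ∀ x ∈ g, x ∉ Z := fun x hx hz => hZq x hz (hgq x hx)
  have hfv : f <:+: v := ⟨[], Z ++ g, by simp [hv]⟩
  have hgv : g <:+: v := ⟨f ++ Z, [], by simp [hv]⟩
  have hZv : Z <:+: v := ⟨f, g, by simp [hv]⟩
  obtain ⟨f', l, hfl⟩ := eq_nil_or_concat f |>.resolve_left hf0
  obtain ⟨e, r, her⟩ := exists_cons_of_ne_nil (l := Z ++ g) (by simp [hg0])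
  have hle : [l, e] <:+: v := ⟨f', r, by
    have : v = f ++ (Z ++ g) := by simp [hv]
    rw [this, her, hfl]; simp⟩
  have hsf : Sym f := f_Sym hG.rd hpf hfv (Sym_pal hpp) hfp (l := l) (e := e) (by simp [hfl])
    (fun hef => by
      have : e ∈ Z ++ g := by rw [her]; simp
      rcases mem_append.1 this with h | h
      · exact hfZ e hef h
      · exact hfg e hef h) hle
  obtain ⟨r', m, hrm⟩ := eq_nil_or_concat (f ++ Z) |>.resolve_left (by simp [hf0])
  obtain ⟨γ, g', hγ⟩ := exists_cons_of_ne_nil hg0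
  have hmg : m ∉ g := by
    intro hmg
    have : m ∈ f ++ Z := by rw [hrm]; simp
    rcases mem_append.1 this with h | h
    · exact hfg m h hmg
    · exact hgZ m hmg h
  have hmγ : [m, γ] <:+: v := ⟨r', g', by rw [hv, hrm, hγ]; simp⟩
  have hsg : Sym g := by
    have := f_Sym (v := v.reverse) (p := q) (f := g.reverse) (l := γ) (e := m) hG.ld
      (by rw [← hqp]; exact reverse_infix.2 hqg)
      (reverse_infix.2 hgv) (Sym_pal hqp) (by simpa using hgq) (by simp [hγ])
      (by simpa using hmg) (pair_reverse.2 hmγ)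
    simpa using Sym_reverse this
  have hRf := rich_of_Sym (RD_infix hG.rd hfv) (NS_infix hG.ns hfv) hsf
  have hRg := rich_of_Sym (RD_infix hG.rd hgv) (NS_infix hG.ns hgv) hsg
  -- `γ` has a predecessor in `g`
  have hpred : ∃ k, [k, γ] <:+: g := by
    by_contra hno
    push Not at hno
    have hall : ∀ z ∈ g, z = γ := by
      intro z hz
      refine closed_all (S := fun z => z = γ) (v := g) ?_ (by simp [hγ]) hz rfl
      intro x1 y1 hxy1
      constructor
      · rintro rfl; exact absurd (hsg _ _ hxy1) (hno _)
      · rintro rfl; exact absurd hxy1 (hno _)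
    obtain ⟨b, t, hbt, hb⟩ := hG.lr
    cases g' with
    | nil =>
      rw [hv, hγ] at hbt
      simp only [reverse_append, reverse_cons, reverse_nil, nil_append, singleton_append,
        cons.injEq] at hbt
      obtain ⟨rfl, rfl⟩ := hbt
      have hγg : γ ∈ g := by simp [hγ]
      simp at hb
      rcases hb with h | h
      · exact hgZ _ hγg h
      · exact hfg _ h hγg
    | cons y g' =>
      have := hall y (by simp [hγ])
      subst this
      exact hno y ⟨[], g', by simp [hγ]⟩
  obtain ⟨k, hk⟩ := hpred
  have hRZ : Rich Z := by
    apply rich_nodup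
    apply nodup_mid hf0 hfZ
    have hi : f ++ Z <:+: v := ⟨[], g, by simp [hv]⟩
    intro z hz x y hx hy
    by_contra hxy
    have hγz := hG.ld.1 z γ x y k m (pair_reverse.2 (hx.trans hi)) (pair_reverse.2 (hy.trans hi))
      (pair_reverse.2 (hk.trans hgv)) (pair_reverse.2 hmγ) hxy (by
        rintro rfl; exact hmg (hk.subset (by simp)))
    subst hγz
    exact hgZ z (by simp [hγ]) hz
  rw [hv]
  apply rich_append (rich_append hRf hRZ hfZ) hRg
  intro x hx hxg
  rcases mem_append.1 hx with h | h
  · exact hfg _ h hxg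
  · exact hgZ _ hxg h


/-! ### Rich hearts -/

theorem split_first {k : A} {l : List A} (h : k ∈ l) : ∃ s t, l = s ++ k :: t ∧ k ∉ s :=
  List.eq_append_cons_of_mem h

theorem split_last {k : A} {l : List A} (h : k ∈ l) : ∃ s t, l = s ++ k :: t ∧ k ∉ t := by
  obtain ⟨s, t, h1, h2⟩ := split_first (l := l.reverse) (k := k) (by simpa using h)
  refine ⟨t.reverse, s.reverse, ?_, by simpa using h2⟩
  rw [← reverse_inj, h1]; simp

theorem Sym_of_nocut {v : List A} (h : Rich v)
    (hc : ∀ s t, v = s ++ t → s ≠ [] → t ≠ [] → ∃ k ∈ s, k ∈ t) : Sym v := by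
  rintro x y ⟨s, t, hst⟩
  obtain ⟨k, hk1, hk2⟩ := hc (s ++ [x]) (y :: t) (by rw [← hst]; simp) (by simp) (by simp)
  obtain ⟨s1, s2, hs, hks⟩ := split_last hk1
  obtain ⟨t1, t2, ht, hkt⟩ := split_first hk2
  have hin : k :: (s2 ++ t1) ++ [k] <:+: v := ⟨s1, t2, by
    have : v = (s ++ [x]) ++ (y :: t) := by rw [← hst]; simp
    rw [this, hs, ht]; simp⟩
  have hpal := Rich.letter_return h hin (by simp [hks, hkt])
  have hpal2 : (k :: (s2 ++ t1) ++ [k]).reverse = k :: (s2 ++ t1) ++ [k] := by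
    simp only [reverse_append, reverse_cons] at hpal ⊢
    rw [hpal]; simp
  obtain ⟨r, x', hr⟩ := eq_nil_or_concat (k :: s2) |>.resolve_left (by simp)
  obtain ⟨y', r', hr'⟩ := exists_cons_of_ne_nil (l := t1 ++ [k]) (by simp)
  have hx : x = x' := by
    rw [hr] at hs
    have : s ++ [x] = (s1 ++ r) ++ [x'] := by rw [hs]; simp
    simpa using (append_inj' this rfl).2
  have hy : y = y' := by
    have : y :: t = (t1 ++ [k]) ++ t2 := by rw [ht]; simp
    rw [hr'] at this
    simp at this; exact this.1
  subst hx; subst hy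
  have : [x, y] <:+: k :: (s2 ++ t1) ++ [k] := ⟨r, r', by
    have : k :: (s2 ++ t1) ++ [k] = (k :: s2) ++ (t1 ++ [k]) := by simp
    rw [this, hr, hr']; simp⟩
  exact (Sym_pal hpal2 _ _ this).trans hin

theorem two_le_max {v p : List A} (h : Rich v) (hr : HR v)
    (hpmax : ∀ p' : List A, p' <+: v → p'.reverse = p' → p'.length ≤ p.length) :
    2 ≤ p.length := by
  obtain ⟨b, t, rfl, hb⟩ := hr
  obtain ⟨s, r, rfl, hs⟩ := split_first hb
  have hpre : b :: s ++ [b] <+: b :: (s ++ b :: r) := ⟨r, by simp⟩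
  have hpal := Rich.letter_return h hpre.isInfix hs
  have := hpmax _ hpre (by simp [hpal])
  simp at this; omega

theorem head_succ {v : List A} {a b : A} (hs : star a v) (hr : HR v) (hb : v.head? = some b)
    (hba : b ≠ a) : [a, b] <:+: v := by
  obtain ⟨b', t, rfl, hbt⟩ := hr
  simp at hb; subst hb
  obtain ⟨s, r, rfl⟩ := append_of_mem hbt
  obtain ⟨r', m, hm⟩ := eq_nil_or_concat (b' :: s) |>.resolve_left (by simp)
  have : [m, b'] <:+: b' :: (s ++ b' :: r) := ⟨r', r, by
    have : b' :: (s ++ b' :: r) = (b' :: s) ++ b' :: r := by simp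
    rw [this, hm]; simp⟩
  have e := (hs _ _ this).resolve_right hba
  rw [← e]; exact this

theorem nocut_case {v p q : List A} (hG : Good v) (h : Rich v)
    (hp : p <+: v) (hppal : p.reverse = p)
    (hpmax : ∀ p' : List A, p' <+: v → p'.reverse = p' → p'.length ≤ p.length)
    (hq : q <:+ v) (hqpal : q.reverse = q)
    (hqmax : ∀ q' : List A, q' <:+ v → q'.reverse = q' → q'.length ≤ q.length)
    (hc : ∀ s t, v = s ++ t → s ≠ [] → t ≠ [] → ∃ k ∈ s, k ∈ t) :
    v.length ≤ p.length + q.length ∨ ∃ x, v = p ++ [x] ++ q ∧ x ∈ p ∧ x ∈ q := by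
  have hvne : v ≠ [] := by
    obtain ⟨b, t, h, _⟩ := hG.hr
    rw [h]; simp
  obtain ⟨a, ha, hS⟩ := SN_of_Sym hG.rd hG.ns (Sym_of_nocut h hc) hvne
  obtain ⟨b, c, hb, hcl⟩ := head_last_exists hvne
  obtain ⟨h0, h1⟩ := sepSN hS hb hcl (head_succ hS.1 hG.hr hb)
    (fun hca => pair_reverse.1 (head_succ (star_reverse hS.1) hG.lr (by simpa using hcl) hca))
  have conv : ∀ k, Sep k v → v.length + k ≤ p.length + q.length + 1 := by
    rintro k ⟨P, Q, -, -, h3, h4, h5, h6, h7⟩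
    have := hpmax P h3 h5
    have := hqmax Q h4 h6
    omega
  by_cases hle : v.length ≤ p.length + q.length
  · exact Or.inl hle
  · right
    have hlen := conv 0 h0
    have hba : b ≠ a := fun e => hle (by have := conv 1 (h1 (Or.inl e)); omega)
    have hca : c ≠ a := fun e => hle (by have := conv 1 (h1 (Or.inr e)); omega)
    have hp2 := two_le_max h hG.hr hpmax
    have hq2 : 2 ≤ q.length := two_le_max (v := v.reverse) ((rich_reverse v).2 h) hG.lr (by
      intro q' h1 h2
      apply hqmax q' _ h2
      rw [← h2, ← reverse_prefix]; simpa using h1)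
    have hp0 : p ≠ [] := by rintro rfl; simp at hp2
    have hq0 : q ≠ [] := by rintro rfl; simp at hq2
    have hph : p.head? = some b := by rw [← prefix_head hp hp0, hb]
    have hql : q.getLast? = some c := by rw [← suffix_last hq hq0, hcl]
    have hap : a ∈ p := (star_ends (star_infix hS.1 hp.isInfix) hph hp2 hba).subset (by simp)
    have haq : a ∈ q := (star_ends_last (star_infix hS.1 hq.isInfix) hql hq2 hca).subset (by simp)
    obtain ⟨r, hr⟩ := hp
    have hqr : q <:+ r := suffix_of_suffix_length_le hq ⟨p, hr⟩ (by
      rw [← hr] at hle; simp at hle; omega)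
    obtain ⟨x', hx'⟩ := hqr
    have hxl : x'.length = 1 := by
      rw [← hr, ← hx'] at hlen hle
      simp only [length_append] at hlen hle; omega
    obtain ⟨x, rfl⟩ := List.length_eq_one_iff.1 hxl
    have hv : v = p ++ [x] ++ q := by rw [← hr, ← hx']; simp
    obtain ⟨p', hp'⟩ := List.getLast?_eq_some_iff.1 ((pal_getLast hppal).trans hph)
    have := (hS.1 b x ⟨p', q, by rw [hv, hp']; simp⟩).resolve_left hba
    subst this
    exact ⟨x, hv, hap, haq⟩

def Cut (v f h : List A) : Prop := v = f ++ h ∧ f ≠ [] ∧ h ≠ [] ∧ ∀ k ∈ f, k ∉ h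

theorem exists_min_cut {v : List A} (hex : ∃ f h, Cut v f h) :
    ∃ f h, Cut v f h ∧ ∀ f' h', Cut v f' h' → f.length ≤ f'.length := by
  classical
  have hex' : ∃ n, ∃ f h, Cut v f h ∧ f.length = n := by
    obtain ⟨f, h, hc⟩ := hex; exact ⟨_, f, h, hc, rfl⟩
  obtain ⟨f, h, hc, hl⟩ := Nat.find_spec hex'
  exact ⟨f, h, hc, fun f' h' hc' => by rw [hl]; exact Nat.find_min' hex' ⟨f', h', hc', rfl⟩⟩

theorem Cut_reverse {v f h : List A} (hc : Cut v f h) : Cut v.reverse h.reverse f.reverse := by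
  obtain ⟨rfl, h1, h2, h3⟩ := hc
  refine ⟨by simp, by simpa using h2, by simpa using h1, ?_⟩
  intro k hk hk'
  exact h3 k (by simpa using hk') (by simpa using hk)

theorem min_cut_structure {v p f h : List A} (hR : RD v) (hr : HR v) (hRich : Rich v)
    (hp : p <+: v) (hppal : p.reverse = p)
    (hpmax : ∀ p' : List A, p' <+: v → p'.reverse = p' → p'.length ≤ p.length)
    (hc : Cut v f h) (hmin : ∀ f' h', Cut v f' h' → f.length ≤ f'.length) :
    ∃ u₁, f = p ++ u₁ ∧ ∀ x ∈ f, x ∈ p := by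
  obtain ⟨hv, hf0, hh0, hd⟩ := hc
  have hp2 := two_le_max hRich hr hpmax
  have hfv : f <:+: v := ⟨[], h, by simp [hv]⟩
  -- no internal cut
  have hsf : Sym f := by
    apply Sym_of_nocut (Rich_of_factor hRich hfv)
    intro s t hst hs ht
    by_contra hcon
    push Not at hcon
    have := hmin s (t ++ h) ⟨by rw [hv, hst]; simp, hs, by simp [ht], by
      intro k hk hk'
      rcases mem_append.1 hk' with h' | h'
      · exact hcon k hk h'
      · exact hd k (by simp [hst, hk]) h'⟩
    rw [hst] at this
    have h3 := length_pos_iff.2 ht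
    simp only [length_append] at this; omega
  obtain ⟨f', l, hfl⟩ := eq_nil_or_concat f |>.resolve_left hf0
  obtain ⟨e, h', he⟩ := exists_cons_of_ne_nil hh0
  have hdet := f_det hR (infix_refl f) hfv hsf (fun x hx => hx) (l := l) (e := e) (by simp [hfl])
    (fun hef => hd e hef (by simp [he])) ⟨f', h', by rw [hv, hfl, he]; simp⟩
  -- `p` is a prefix of `f`
  have hple : p.length ≤ f.length := by
    by_contra hlt
    have hfp : f <+: p := prefix_of_prefix_length_le ⟨h, hv.symm⟩ hp (by omega)
    obtain ⟨r, hr'⟩ := hfp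
    have hr0 : r ≠ [] := by
      rintro rfl; simp at hr'; rw [hr'] at hlt; omega
    have hrh : r <+: h := by
      rw [hv, ← hr'] at hp
      simpa using hp
    have h1 := pal_getLast hppal
    rw [prefix_head (p := f) ⟨r, hr'⟩ hf0, suffix_last (p := r) ⟨f, hr'⟩ hr0] at h1
    obtain ⟨b, t, hbt⟩ := exists_cons_of_ne_nil hf0
    rw [hbt] at h1
    simp at h1
    have hbr : b ∈ r := List.mem_of_mem_getLast? (by simp [h1])
    exact hd b (by simp [hbt]) (hrh.subset hbr)
  have hpf : p <+: f := prefix_of_prefix_length_le hp ⟨h, hv.symm⟩ hple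
  obtain ⟨u₁, hu₁⟩ := hpf
  refine ⟨u₁, hu₁.symm, ?_⟩
  obtain ⟨α, β, p', hp'⟩ : ∃ α β p', p = α :: β :: p' := by
    match p, hp2 with
    | α :: β :: p', _ => exact ⟨α, β, p', rfl⟩
  have hαβ : [α, β] <:+: f := ⟨[], p' ++ u₁, by rw [← hu₁, hp']; simp⟩
  have hβα := hsf _ _ hαβ
  intro x hx
  have := closed_all (S := fun z => z = α ∨ z = β) (v := f) (a := α) (b := x) (by
    have one : ∀ x y, [x, y] <:+: f → (x = α ∨ x = β) → (y = α ∨ y = β) := by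
      rintro x y hxy (rfl | rfl)
      · exact Or.inr (hdet _ _ _ hxy hαβ)
      · exact Or.inl (hdet _ _ _ hxy hβα)
    exact fun x y hxy => ⟨one x y hxy, one y x (hsf _ _ hxy)⟩)
    (hαβ.subset (by simp)) hx (Or.inl rfl)
  rw [hp']; simp; tauto

theorem cut_case {v p q : List A} (hG : Good v) (h : Rich v)
    (hp : p <+: v) (hppal : p.reverse = p)
    (hpmax : ∀ p' : List A, p' <+: v → p'.reverse = p' → p'.length ≤ p.length)
    (hq : q <:+ v) (hqpal : q.reverse = q)
    (hqmax : ∀ q' : List A, q' <:+ v → q'.reverse = q' → q'.length ≤ q.length)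
    (hex : ∃ f h, Cut v f h) :
    ∃ u₁ Z u₂, v = p ++ u₁ ++ Z ++ (u₂ ++ q) ∧ (∀ x ∈ p, x ∉ q) ∧ (∀ x ∈ u₁, x ∈ p) ∧
      (∀ x ∈ u₂, x ∈ q) ∧ (∀ x ∈ Z, x ∉ p ∧ x ∉ q) := by
  obtain ⟨f, h1, hc, hmin⟩ := exists_min_cut hex
  obtain ⟨g, h2, hcg, hming⟩ := exists_min_cut (v := v.reverse) (by
    obtain ⟨f, h, hc⟩ := hex; exact ⟨_, _, Cut_reverse hc⟩)
  obtain ⟨u₁, hf, hfp⟩ := min_cut_structure hG.rd hG.hr h hp hppal hpmax hc hmin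
  obtain ⟨u₂, hg, hgq⟩ := min_cut_structure (p := q) hG.ld hG.lr ((rich_reverse v).2 h)
    (by rw [← hqpal]; exact reverse_prefix.2 hq) hqpal (by
      intro q' h1 h2
      apply hqmax q' _ h2
      rw [← h2, ← reverse_prefix]; simpa using h1) hcg hming
  have hcg' := Cut_reverse hcg
  rw [reverse_reverse] at hcg'
  obtain ⟨hv, hf0, hh0, hd⟩ := hc
  obtain ⟨hv', hf0', hh0', hd'⟩ := hcg'
  have hle := hmin _ _ ⟨hv', hf0', hh0', hd'⟩
  have hpre : f <+: h2.reverse := prefix_of_prefix_length_le ⟨h1, hv.symm⟩ ⟨_, hv'.symm⟩ hle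
  obtain ⟨Z, hZ⟩ := hpre
  have hgrev : g.reverse = u₂.reverse ++ q := by rw [hg]; simp [hqpal]
  have hh1 : h1 = Z ++ g.reverse := by
    rw [hv', ← hZ, append_assoc] at hv
    exact (append_cancel_left hv).symm
  have hqg : ∀ x ∈ q, x ∈ g.reverse := by
    intro x hx; rw [hgrev]; simp [hx]
  have hpf : ∀ x ∈ p, x ∈ f := by
    intro x hx; rw [hf]; simp [hx]
  refine ⟨u₁, Z, u₂.reverse, ?_, ?_, ?_, ?_, ?_⟩
  · rw [← hgrev, ← hf, hv', ← hZ]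
  · intro x hx hxq
    exact hd x (hpf x hx) (by rw [hh1]; exact mem_append_right _ (hqg x hxq))
  · intro x hx; exact hfp x (by rw [hf]; simp [hx])
  · intro x hx; exact hgq x (by rw [hg]; simp at hx; simp [hx])
  · intro x hx
    constructor
    · intro hxp
      exact hd x (hpf x hxp) (by rw [hh1]; simp [hx])
    · intro hxq
      exact hd' x (by rw [← hZ]; simp [hx]) (hqg x hxq)


/-! ### The heart -/

def Cond (v p q : List A) : Prop :=
  (v.length ≤ p.length + q.length) ∨
      (∃ x : A, v = p ++ [x] ++ q ∧ (Alph p ∩ Alph q).Nonempty ∧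
        x ∈ Alph p ∪ Alph q) ∨
      (∃ u : List A, u ≠ [] ∧ v = p ++ u ++ q ∧ Alph p ∩ Alph q = ∅ ∧
        ∃ u₁ Z u₂ : List A, u = u₁ ++ Z ++ u₂ ∧
          (u₁ ≠ [] ∨ Z ≠ [] ∨ u₂ ≠ []) ∧
          Alph u₁ ⊆ Alph p ∧ Alph u₂ ⊆ Alph q ∧
          Alph Z ∩ (Alph p ∪ Alph q) = ∅)

theorem mem_Alph {x : A} {w : List A} : x ∈ Alph w ↔ x ∈ w := by simp [Alph]

theorem Alph_inter_empty {p q : List A} : Alph p ∩ Alph q = ∅ ↔ ∀ x ∈ p, x ∉ q := by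
  rw [Finset.eq_empty_iff_forall_notMem]
  simp [mem_Alph]

theorem Alph_inter_union_empty {Z p q : List A} :
    Alph Z ∩ (Alph p ∪ Alph q) = ∅ ↔ ∀ x ∈ Z, x ∉ p ∧ x ∉ q := by
  rw [Finset.eq_empty_iff_forall_notMem]
  simp [mem_Alph]

theorem main_good {v p q : List A} (hG : Good v)
    (hp : p <+: v) (hppal : p.reverse = p)
    (hpmax : ∀ p' : List A, p' <+: v → p'.reverse = p' → p'.length ≤ p.length)
    (hq : q <:+ v) (hqpal : q.reverse = q)
    (hqmax : ∀ q' : List A, q' <:+ v → q'.reverse = q' → q'.length ≤ q.length) :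
    Rich v ↔ Cond v p q := by
  have hp0 : p ≠ [] := by
    obtain ⟨b, t, h, _⟩ := hG.hr
    have := hpmax [b] ⟨t, by simp [h]⟩ (by simp)
    rintro rfl; simp at this
  have hq0 : q ≠ [] := by
    obtain ⟨b, t, h, _⟩ := hG.lr
    have := hqmax [b] ⟨t.reverse, by rw [← reverse_inj, h]; simp⟩ (by simp)
    rintro rfl; simp at this
  constructor
  · intro h
    by_cases hex : ∃ f h, Cut v f h
    · obtain ⟨u₁, Z, u₂, hv, h1, h2, h3, h4⟩ :=
        cut_case hG h hp hppal hpmax hq hqpal hqmax hex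
      by_cases hu : u₁ ++ Z ++ u₂ = []
      · left
        simp at hu
        rw [hv, hu.1, hu.2.1, hu.2.2]; simp
      · right; right
        refine ⟨_, hu, by rw [hv]; simp, Alph_inter_empty.2 h1, u₁, Z, u₂, rfl, ?_, ?_, ?_,
          Alph_inter_union_empty.2 h4⟩
        · simp at hu; tauto
        · intro x hx; rw [mem_Alph] at hx ⊢; exact h2 x hx
        · intro x hx; rw [mem_Alph] at hx ⊢; exact h3 x hx
    · rcases nocut_case hG h hp hppal hpmax hq hqpal hqmax (by
        intro s t hst hs ht
        by_contra hcon
        push Not at hcon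
        exact hex ⟨s, t, hst, hs, ht, hcon⟩) with h1 | ⟨x, h1, h2, h3⟩
      · exact Or.inl h1
      · refine Or.inr (Or.inl ⟨x, h1, ⟨x, ?_⟩, ?_⟩) <;> simp [mem_Alph, h2, h3]
  · rintro (h | ⟨x, hv, ⟨k, hk⟩, hx⟩ | ⟨u, hu, hv, hpq, u₁, Z, u₂, rfl, -, h1, h2, h3⟩)
    · by_cases hd : ∀ x ∈ p, x ∉ q
      · obtain ⟨o, r, hv, hqo⟩ := overlap hp hq h
        have ho : o = [] := by
          by_contra ho
          obtain ⟨o', y, hy⟩ := eq_nil_or_concat o |>.resolve_left ho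
          have hop : o <:+ p := by
            obtain ⟨z, hz⟩ := hq
            rw [hqo, hv, ← append_assoc] at hz
            exact ⟨z, append_cancel_right hz⟩
          have hyo : y ∈ o := by simp [hy]
          exact hd y (hop.subset hyo) (by rw [hqo]; simp [hyo])
        subst ho
        simp at hqo
        subst hqo
        exact rich_of_disj (u₁ := []) (Z := []) (u₂ := []) hG (by simpa using hv) hp0 hq0 hppal
          hqpal hd (by simp) (by simp) (by simp) (by simp)
      · push Not at hd
        obtain ⟨k, hk1, hk2⟩ := hd
        exact rich_of_Sym hG.rd hG.ns (Sym_of_touch hG.rd hp hq hppal hqpal h hk1 hk2)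
    · simp only [Finset.mem_inter, Finset.mem_union, mem_Alph] at hk hx
      exact rich_of_Sym hG.rd hG.ns (Sym_of_gap hG.rd hG.ld hv hppal hqpal hk.1 hk.2 hx)
    · rw [Alph_inter_empty] at hpq
      rw [Alph_inter_union_empty] at h3
      refine rich_of_disj (u₁ := u₁) (Z := Z) (u₂ := u₂) hG (by rw [hv]; simp) hp0 hq0 hppal
        hqpal hpq ?_ ?_ (fun x hx => (h3 x hx).1) (fun x hx => (h3 x hx).2)
      · intro x hx; exact mem_Alph.1 (h1 (mem_Alph.2 hx))
      · intro x hx; exact mem_Alph.1 (h2 (mem_Alph.2 hx))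

theorem DD_strip {r v : List A} (hr : r.Nodup) (hd : ∀ x ∈ r, x ∉ v) (h : DD (r ++ v)) : DD v := by
  induction r with
  | nil => exact h
  | cons z r ih =>
    rw [nodup_cons] at hr
    refine ih hr.2 (fun x hx => hd x (mem_cons_of_mem _ hx)) (DD_of_cons (z := z) ?_ h)
    rw [mem_append]
    rintro (h' | h')
    · exact hr.1 h'
    · exact hd z mem_cons_self h'

theorem heart_decomp {w : List A} (h : ¬ ∀ x ∈ w, w.count x = 1) :
    ∃ r s, w = r ++ heart w ++ s ∧ (∀ x ∈ r, w.count x = 1) ∧ (∀ x ∈ s, w.count x = 1) ∧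
      (∃ b t, heart w = b :: t ∧ w.count b ≠ 1) ∧
      ∃ b t, (heart w).reverse = b :: t ∧ w.count b ≠ 1 := by
  have hheart : heart w = ((w.dropWhile (fun x => w.count x == 1)).reverse.dropWhile
      (fun x => w.count x == 1)).reverse := by
    unfold heart; rw [if_neg h]
  set P : A → Bool := fun x => w.count x == 1 with hP
  have hPt : ∀ x, P x = true ↔ w.count x = 1 := by intro x; simp [hP]
  have hw1 : w.takeWhile P ++ w.dropWhile P = w := takeWhile_append_dropWhile
  set w1 := w.dropWhile P with hw1def
  have hw2 : w1.reverse.takeWhile P ++ w1.reverse.dropWhile P = w1.reverse :=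
    takeWhile_append_dropWhile
  have hw3 : w1 = heart w ++ (w1.reverse.takeWhile P).reverse := by
    rw [hheart, ← reverse_append, hw2, reverse_reverse]
  have hr : ∀ x ∈ w.takeWhile P, w.count x = 1 := fun x hx => (hPt x).1 (mem_takeWhile_imp hx)
  have hs : ∀ x ∈ (w1.reverse.takeWhile P).reverse, w.count x = 1 := fun x hx =>
    (hPt x).1 (mem_takeWhile_imp (mem_reverse.1 hx))
  have hdec : w = w.takeWhile P ++ heart w ++ (w1.reverse.takeWhile P).reverse := by
    rw [append_assoc, ← hw3, hw1]
  have hne : heart w ≠ [] := by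
    intro h0
    apply h
    intro x hx
    rw [hdec, h0] at hx
    simp only [append_nil, mem_append] at hx
    rcases hx with h' | h'
    · exact hr x h'
    · exact hs x h'
  refine ⟨_, _, hdec, hr, hs, ?_, ?_⟩
  · obtain ⟨b, t, hbt⟩ := exists_cons_of_ne_nil hne
    refine ⟨b, t, hbt, ?_⟩
    have h1 : w1 = b :: (t ++ (w1.reverse.takeWhile P).reverse) := by
      conv_lhs => rw [hw3, hbt]
      rfl
    have h2 := head?_dropWhile_not P w
    rw [← hw1def, h1] at h2
    simp at h2
    intro h3
    rw [(hPt b).2 h3] at h2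
    simp at h2
  · obtain ⟨b, t, hbt⟩ := exists_cons_of_ne_nil (l := (heart w).reverse) (by simpa using hne)
    refine ⟨b, t, hbt, ?_⟩
    have h2 := head?_dropWhile_not P w1.reverse
    have h1 : w1.reverse.dropWhile P = b :: t := by rw [← hbt, hheart, reverse_reverse]
    rw [h1] at h2
    simp at h2
    intro h3
    rw [(hPt b).2 h3] at h2
    simp at h2

theorem good_heart {w : List A} (hw : IsGT w) (h : ¬ ∀ x ∈ w, w.count x = 1) :
    Good (heart w) ∧ (Rich w ↔ Rich (heart w)) := by
  obtain ⟨r, s, hdec, hr, hs, ⟨b, t, hbt, hb⟩, c, t', hct, hc⟩ := heart_decomp h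
  generalize heart w = v at *
  have hcount : ∀ x, w.count x = r.count x + v.count x + s.count x := by
    intro x; conv_lhs => rw [hdec]
    simp; omega
  have hrn : r.Nodup := nodup_iff_count_le_one.2 fun x => by
    by_cases hx : x ∈ r
    · have := hr x hx; have := hcount x; omega
    · rw [count_eq_zero_of_not_mem hx]; omega
  have hsn : s.Nodup := nodup_iff_count_le_one.2 fun x => by
    by_cases hx : x ∈ s
    · have := hs x hx; have := hcount x; omega
    · rw [count_eq_zero_of_not_mem hx]; omega
  have hrd : ∀ x ∈ r, x ∉ v ++ s := by
    intro x hx hx'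
    have h1 := hr x hx; have h2 := hcount x
    have h3 := count_pos_iff.2 hx
    have h4 := count_pos_iff.2 hx'
    rw [count_append] at h4
    omega
  have hsd : ∀ x ∈ s, x ∉ v := by
    intro x hx hx'
    have h1 := hs x hx; have h2 := hcount x
    have h3 := count_pos_iff.2 hx
    have h4 := count_pos_iff.2 hx'
    omega
  have hDv : DD v := by
    have h1 : DD (v ++ s) := DD_strip hrn hrd (by rw [← append_assoc, ← hdec]; exact DD_of_GT hw)
    have h2 := DD_reverse h1
    rw [reverse_append] at h2
    have h3 := DD_strip (nodup_reverse.2 hsn) (by simpa using hsd) h2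
    simpa using DD_reverse h3
  have hrep : ∀ x, x ∈ v → w.count x ≠ 1 → 2 ≤ v.count x := by
    intro x hx hx1
    have h1 : x ∉ r := fun h => hx1 (hr x h)
    have h2 : x ∉ s := fun h => hx1 (hs x h)
    have h3 := hcount x
    rw [count_eq_zero_of_not_mem h1, count_eq_zero_of_not_mem h2] at h3
    have := count_pos_iff.2 hx
    omega
  have hHR : HR v := by
    refine ⟨b, t, hbt, ?_⟩
    have := hrep b (by simp [hbt]) hb
    rw [hbt, count_cons_self] at this
    exact count_pos_iff.1 (by omega)
  have hHR' : HR v.reverse := by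
    refine ⟨c, t', hct, ?_⟩
    have := hrep c (by rw [← mem_reverse, hct]; simp) hc
    rw [← count_reverse, hct, count_cons_self] at this
    exact count_pos_iff.1 (by omega)
  have hLRof : ∀ v : List A, HR v.reverse → LR v := by
    rintro v ⟨b, t, h1, h2⟩
    exact ⟨t.reverse, b, by simpa using h2, by rw [← reverse_inj, h1]; simp⟩
  have hLR := hLRof v hHR'
  have hLR' := hLRof v.reverse (by simpa using hHR)
  refine ⟨⟨RD_of_DD hDv hLR, RD_of_DD (DD_reverse hDv) hLR', NS_of_DD hDv hLR hLR', hHR, hHR'⟩, ?_⟩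
  constructor
  · intro hR
    exact Rich_of_factor hR ⟨r, s, hdec.symm⟩
  · intro hR
    rw [hdec, append_assoc]
    refine rich_append (rich_nodup hrn) (rich_append hR (rich_nodup hsn) ?_) hrd
    intro x hx hxs
    exact hsd x hxs hx

theorem nodup_case {w p q : List A} (hw : w.Nodup) (hp : p <+: w) (hq : q <:+ w) :
    Rich w ↔ Cond w p q := by
  refine ⟨fun _ => ?_, fun _ => rich_nodup hw⟩
  by_cases hle : w.length ≤ p.length + q.length
  · exact Or.inl hle
  · right; right
    obtain ⟨r, hr⟩ := hp
    have hqr : q <:+ r := suffix_of_suffix_length_le hq ⟨p, hr⟩ (by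
      rw [← hr, length_append] at hle; omega)
    obtain ⟨u, hu⟩ := hqr
    have hv : w = p ++ u ++ q := by rw [← hr, ← hu]; simp
    have hu0 : u ≠ [] := by
      rintro rfl; rw [hv] at hle; simp at hle
    rw [hv, nodup_append, nodup_append] at hw
    obtain ⟨⟨_, _, h1⟩, _, h2⟩ := hw
    refine ⟨u, hu0, hv, Alph_inter_empty.2 ?_, [], u, [], by simp, Or.inr (Or.inl hu0), ?_, ?_,
      Alph_inter_union_empty.2 ?_⟩
    · intro x hx hxq
      exact h2 x (by simp [hx]) x hxq rfl
    · simp [Alph]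
    · simp [Alph]
    · intro x hx
      exact ⟨fun hxp => h1 x hxp x hx rfl, fun hxq => h2 x (by simp [hx]) x hxq rfl⟩

theorem main_thm (w : List A) (hw : IsGT w) (v p q : List A) (hv : v = heart w)
    (hp : p <+: v) (hppal : p.reverse = p)
    (hpmax : ∀ p' : List A, p' <+: v → p'.reverse = p' → p'.length ≤ p.length)
    (hq : q <:+ v) (hqpal : q.reverse = q)
    (hqmax : ∀ q' : List A, q' <:+ v → q'.reverse = q' → q'.length ≤ q.length) :
    Rich w ↔ Cond v p q := by
  by_cases h : ∀ x ∈ w, w.count x = 1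
  · have hvw : v = w := by rw [hv]; unfold heart; rw [if_pos h]
    subst hvw
    refine nodup_case (nodup_iff_count_le_one.2 fun x => ?_) hp hq
    by_cases hx : x ∈ v
    · rw [h x hx]
    · rw [count_eq_zero_of_not_mem hx]; omega
  · obtain ⟨hG, hR⟩ := good_heart hw h
    rw [hR, ← hv]
    rw [← hv] at hG
    exact main_good hG hp hppal hpmax hq hqpal hqmax


end GTW

theorem stmt16 (w : List A) (hw : IsGT w) (v p q : List A) (hv : v = heart w)
    (hp : p <+: v) (hppal : p.reverse = p)
    (hpmax : ∀ p' : List A, p' <+: v → p'.reverse = p' → p'.length ≤ p.length)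
    (hq : q <:+ v) (hqpal : q.reverse = q)
    (hqmax : ∀ q' : List A, q' <:+ v → q'.reverse = q' → q'.length ≤ q.length) :
    Rich w ↔
      (v.length ≤ p.length + q.length) ∨
      (∃ x : A, v = p ++ [x] ++ q ∧ (Alph p ∩ Alph q).Nonempty ∧
        x ∈ Alph p ∪ Alph q) ∨
      (∃ u : List A, u ≠ [] ∧ v = p ++ u ++ q ∧ Alph p ∩ Alph q = ∅ ∧
        ∃ u₁ Z u₂ : List A, u = u₁ ++ Z ++ u₂ ∧
          (u₁ ≠ [] ∨ Z ≠ [] ∨ u₂ ≠ []) ∧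
          Alph u₁ ⊆ Alph p ∧ Alph u₂ ⊆ Alph q ∧
          Alph Z ∩ (Alph p ∪ Alph q) = ∅) := by
  exact GTW.main_thm w hw v p q hv hp hppal hpmax hq hqpal hqmax
end
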